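/- arXiv:2402.17089 — 4 statements merged into one kernel-verified Lean document; each statement's English description precedes it below -/
import Mathlib

section
/- Borsuk–Ulam obstruction to learnability: let Φ : ℝ^W → ℝ^d define gradient flows w_f(t) (solving w' = −∇_w (1/2)‖f − Φ(w)‖², w(0) = 0) depending continuously on the target f, and let g : S^W → ℝ^d be continuous and injective with l = inf_y ‖g(y) − g(−y)‖ > 0. Then for every t ≥ 0 there exists y_t ∈ S^W such that max(L_{g(y_t)}(w_{g(y_t)}(t)), L_{g(−y_t)}(w_{g(−y_t)}(t))) ≥ l²/8. -/
open MeasureTheory Filter Topology Set Metric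

/-- The square loss `L_f(w) = (1/2)‖f - Φ(w)‖²`. -/
noncomputable def loss {W d : ℕ} (Φ : EuclideanSpace ℝ (Fin W) → EuclideanSpace ℝ (Fin d))
    (f : EuclideanSpace ℝ (Fin d)) (w : EuclideanSpace ℝ (Fin W)) : ℝ :=
  (1 / 2) * ‖f - Φ w‖ ^ 2

namespace BU

/-- mod-2 chains on lists of points (augmented ordered chain complex) -/
abbrev Ch (E : Type*) := List E →₀ ZMod 2

section alg
variable {E : Type*}

noncomputable def sg (l : List E) : Ch E := Finsupp.single l 1

noncomputable def lift {M : Type*} [AddCommGroup M] [Module (ZMod 2) M] (f : List E → M) :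
    Ch E →ₗ[ZMod 2] M := Finsupp.linearCombination (ZMod 2) f

@[simp] lemma lift_sg {M : Type*} [AddCommGroup M] [Module (ZMod 2) M] (f : List E → M)
    (l : List E) : lift f (sg l) = f l := by
  simp [lift, sg]

lemma hom_ext {M : Type*} [AddCommGroup M] [Module (ZMod 2) M] {A B : Ch E →ₗ[ZMod 2] M}
    (h : ∀ l, A (sg l) = B (sg l)) : A = B := by
  apply Finsupp.lhom_ext'
  intro l
  apply LinearMap.ext_ring
  exact h l

lemma hom_ext_apply {M : Type*} [AddCommGroup M] [Module (ZMod 2) M] (A B : Ch E →ₗ[ZMod 2] M)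
    (h : ∀ l, A (sg l) = B (sg l)) (c : Ch E) : A c = B c := by
  rw [hom_ext h]

/-- chains spanned by lists with property `P` -/
noncomputable def Sup (P : List E → Prop) : Submodule (ZMod 2) (Ch E) :=
  Submodule.span (ZMod 2) (sg '' {l | P l})

lemma sg_mem {P : List E → Prop} {l : List E} (h : P l) : sg l ∈ Sup P :=
  Submodule.subset_span ⟨l, h, rfl⟩

lemma eq_on_Sup {M : Type*} [AddCommGroup M] [Module (ZMod 2) M] {P : List E → Prop}
    (A B : Ch E →ₗ[ZMod 2] M) (h : ∀ l, P l → A (sg l) = B (sg l)) {c : Ch E} (hc : c ∈ Sup P) :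
    A c = B c := by
  have : Set.EqOn A B (Sup P : Set (Ch E)) := by
    apply LinearMap.eqOn_span
    rintro _ ⟨l, hl, rfl⟩
    exact h l hl
  exact this hc

lemma map_mem {M : Type*} [AddCommGroup M] [Module (ZMod 2) M] {P : List E → Prop}
    (A : Ch E →ₗ[ZMod 2] M) (N : Submodule (ZMod 2) M) (h : ∀ l, P l → A (sg l) ∈ N)
    {c : Ch E} (hc : c ∈ Sup P) : A c ∈ N := by
  have : Sup P ≤ N.comap A := by
    apply Submodule.span_le.2
    rintro _ ⟨l, hl, rfl⟩
    exact h l hl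
  exact this hc

lemma Sup_mono {P Q : List E → Prop} (h : ∀ l, P l → Q l) : Sup P ≤ Sup Q :=
  fun _ hc => map_mem LinearMap.id (Sup Q) (fun l hl => sg_mem (h l hl)) hc

noncomputable def cone (v : E) : Ch E →ₗ[ZMod 2] Ch E := lift fun l => sg (v :: l)

@[simp] lemma cone_sg (v : E) (l : List E) : cone v (sg l) = sg (v :: l) := by simp [cone]

noncomputable def bdB : List E → Ch E
  | [] => 0
  | v :: l => sg l + cone v (bdB l)

noncomputable def bd : Ch E →ₗ[ZMod 2] Ch E := lift bdB

@[simp] lemma bd_sg_nil : bd (sg ([] : List E)) = 0 := by simp [bd, bdB]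

@[simp] lemma bd_sg_cons (v : E) (l : List E) :
    bd (sg (v :: l)) = sg l + cone v (bd (sg l)) := by simp [bd, bdB]

attribute [irreducible] lift sg cone bd

lemma add_self (c : Ch E) : c + c = 0 := ZModModule.add_self c

lemma bd_cone (v : E) (c : Ch E) : bd (cone v c) = c + cone v (bd c) :=
  hom_ext_apply (bd ∘ₗ cone v) (LinearMap.id + cone v ∘ₗ bd) (by intro l; simp) c

lemma bd_bd (c : Ch E) : bd (bd c) = 0 := by
  refine hom_ext_apply (bd ∘ₗ bd) 0 ?_ c
  intro l
  induction l with
  | nil => simp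
  | cons v l ih =>
    simp only [LinearMap.comp_apply, LinearMap.zero_apply] at ih
    simp [bd_cone, ih, add_self]

lemma bd_sg_mem (l : List E) (n : ℕ) (hl : l.length = n + 1) :
    bd (sg l) ∈ Sup (fun m => m.length = n ∧ ∀ x ∈ m, x ∈ l) := by
  induction l generalizing n with
  | nil => simp at hl
  | cons v l ih =>
    rw [bd_sg_cons]
    have hl' : l.length = n := by simpa using hl
    refine Submodule.add_mem _ (sg_mem ⟨hl', fun x hx => List.mem_cons_of_mem _ hx⟩) ?_
    cases n with
    | zero =>
      obtain rfl : l = [] := List.length_eq_zero_iff.1 hl'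
      simp
    | succ n =>
      refine map_mem (cone v) _ ?_ (ih n hl')
      rintro m ⟨h1, h2⟩
      rw [cone_sg]
      refine sg_mem ⟨by simp [h1], ?_⟩
      intro x hx
      rcases List.mem_cons.1 hx with rfl | hx
      · simp
      · exact List.mem_cons_of_mem _ (h2 x hx)

/-! cochains -/

def Om (s : ℕ → E → ZMod 2) : List E → ZMod 2
  | [] => 0
  | [_] => 1
  | v :: w :: l => (s l.length v + s l.length w) * Om s (w :: l)

def ph (s : ℕ → E → ZMod 2) : List E → ZMod 2
  | [] => 0
  | v :: l => s l.length v * Om s (v :: l)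

lemma Om_bd (s : ℕ → E → ZMod 2) (l : List E) : lift (Om s) (bd (sg l)) = 0 := by
  induction l with
  | nil => simp
  | cons w l ih =>
    cases l with
    | nil => simp [Om]
    | cons x l =>
    -- list is w :: x :: l
      cases l with
      | nil =>
        simp only [bd_sg_cons, bd_sg_nil, map_add, map_zero, cone_sg, lift_sg, Om]
        decide
      | cons y l =>
        have key : lift (Om s) (cone w (cone x (bd (sg (y :: l)))))
            = (s l.length w + s l.length x) * lift (Om s) (cone x (bd (sg (y :: l)))) := by
          refine eq_on_Sup (lift (Om s) ∘ₗ cone w ∘ₗ cone x)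
            ((s l.length w + s l.length x) • (lift (Om s) ∘ₗ cone x)) ?_
            (bd_sg_mem (y :: l) l.length (by simp))
          rintro m ⟨h1, -⟩
          simp [Om, h1]
        rw [bd_sg_cons x, map_add, lift_sg] at ih
        have e : lift (Om s) (cone x (bd (sg (y :: l)))) = Om s (y :: l) := by
          rw [eq_comm, ← sub_eq_zero, CharTwo.sub_eq_add]; exact ih
        rw [bd_sg_cons w, bd_sg_cons x, map_add, map_add, map_add, key, e, cone_sg, lift_sg, lift_sg]
        simp only [Om]
        have h2 : (2 : ZMod 2) = 0 := by decide
        linear_combination (s l.length x + s l.length y + s l.length w) * Om s (y :: l) * h2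

lemma ph_bd (s : ℕ → E → ZMod 2) (l : List E) (hl : 2 ≤ l.length) :
    lift (ph s) (bd (sg l)) = Om s l := by
  match l, hl with
  | v :: w :: l, _ =>
    have h := Om_bd s (v :: w :: l)
    rw [bd_sg_cons v, map_add, lift_sg] at h
    have e : lift (Om s) (cone v (bd (sg (w :: l)))) = Om s (w :: l) := by
      rw [eq_comm, ← sub_eq_zero, CharTwo.sub_eq_add]; exact h
    have key : lift (ph s) (cone v (bd (sg (w :: l))))
        = s l.length v * lift (Om s) (cone v (bd (sg (w :: l)))) := by
      refine eq_on_Sup (lift (ph s) ∘ₗ cone v) (s l.length v • (lift (Om s) ∘ₗ cone v)) ?_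
        (bd_sg_mem (w :: l) l.length (by simp))
      rintro m ⟨h1, -⟩
      simp [ph, h1]
    rw [bd_sg_cons v, map_add, key, e, lift_sg]
    simp only [ph, Om]
    ring

lemma Om_ne (s : ℕ → E → ZMod 2) (l : List E) (h : Om s l ≠ 0) (i : ℕ) (hi : i + 1 < l.length) :
    ∃ x ∈ l, ∃ y ∈ l, s i x ≠ s i y := by
  induction l with
  | nil => simp at hi
  | cons v l ih =>
    cases l with
    | nil => simp at hi
    | cons w l =>
      simp only [Om] at h
      by_cases hil : i = l.length
      · refine ⟨v, by simp, w, by simp, ?_⟩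
        intro e
        apply h
        rw [← hil, e, CharTwo.add_self_eq_zero, zero_mul]
      · obtain ⟨x, hx, y, hy, hxy⟩ := ih (right_ne_zero_of_mul h) (by simp at hi ⊢; omega)
        exact ⟨x, List.mem_cons_of_mem _ hx, y, List.mem_cons_of_mem _ hy, hxy⟩

end alg

section inv
variable {E : Type*} [AddCommGroup E]

noncomputable def tau : Ch E →ₗ[ZMod 2] Ch E := lift fun l => sg (l.map (fun x => -x))

@[simp] lemma tau_sg (l : List E) : tau (sg l) = sg (l.map (fun x => -x)) := by simp [tau]

attribute [irreducible] tau

lemma tau_cone (v : E) (c : Ch E) : tau (cone v c) = cone (-v) (tau c) :=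
  hom_ext_apply (tau ∘ₗ cone v) (cone (-v) ∘ₗ tau) (by intro l; simp) c

lemma tau_tau (c : Ch E) : tau (tau c) = c :=
  hom_ext_apply (tau ∘ₗ tau) LinearMap.id (by intro l; simp) c

lemma tau_bd (c : Ch E) : tau (bd c) = bd (tau c) := by
  refine hom_ext_apply (tau ∘ₗ bd) (bd ∘ₗ tau) ?_ c
  intro l
  induction l with
  | nil => simp
  | cons v l ih =>
    simp only [LinearMap.comp_apply] at ih
    simp [tau_cone, ih]

lemma Om_neg (s : ℕ → E → ZMod 2) (l : List E) (h : ∀ x ∈ l, ∀ i, s i (-x) = s i x + 1) :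
    Om s (l.map (fun x => -x)) = Om s l := by
  induction l with
  | nil => rfl
  | cons v l ih =>
    cases l with
    | nil => rfl
    | cons w l =>
      have := ih (fun x hx => h x (List.mem_cons_of_mem _ hx))
      simp only [List.map_cons, Om, List.length_map] at this ⊢
      rw [this, h v (by simp), h w (by simp)]
      have h2 : (2 : ZMod 2) = 0 := by decide
      linear_combination Om s (w :: l) * h2

lemma ph_neg (s : ℕ → E → ZMod 2) (l : List E) (h : ∀ x ∈ l, ∀ i, s i (-x) = s i x + 1) :
    ph s l + ph s (l.map (fun x => -x)) = Om s l := by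
  cases l with
  | nil => simp [ph, Om]
  | cons v l =>
    have := Om_neg s (v :: l) h
    simp only [List.map_cons, ph, List.length_map] at this ⊢
    rw [this, h v (by simp)]
    have h2 : (2 : ZMod 2) = 0 := by decide
    linear_combination s l.length v * Om s (v :: l) * h2

/-- The main algebraic step. -/
lemma Om_chain (s : ℕ → E → ZMod 2) (X : Set E) (h : ∀ x ∈ X, ∀ i, s i (-x) = s i x + 1)
    (n : ℕ) (G : ℕ → Ch E) (v : E) (h0 : G 0 = sg [v])
    (hb : ∀ k < n, bd (G (k + 1)) = G k + tau (G k))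
    (hG : ∀ k ≤ n, G k ∈ Sup (fun l => l.length = k + 1 ∧ ∀ x ∈ l, x ∈ X)) (k : ℕ) (hk : k ≤ n) :
    lift (Om s) (G k) = 1 := by
  induction k with
  | zero => simp [h0, Om]
  | succ k ih =>
    have e1 : lift (Om s) (G (k + 1)) = lift (ph s) (bd (G (k + 1))) := by
      refine eq_on_Sup (lift (Om s)) (lift (ph s) ∘ₗ bd) ?_ (hG (k + 1) hk)
      rintro l ⟨hl, -⟩
      rw [LinearMap.comp_apply, ph_bd s l (by omega), lift_sg]
    have e2 : lift (ph s) (G k + tau (G k)) = lift (Om s) (G k) := by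
      refine eq_on_Sup (lift (ph s) ∘ₗ (LinearMap.id + tau)) (lift (Om s)) ?_ (hG k (by omega))
      rintro l ⟨-, hl⟩
      simp [ph_neg s l (fun x hx => h x (hl x hx))]
    rw [e1, hb k (by omega), e2, ih (by omega)]

end inv

section geom
variable {E : Type*} [NormedAddCommGroup E] [NormedSpace ℝ E]

noncomputable def bary (l : List E) : E := ((l.length : ℝ)⁻¹) • l.sum

lemma bary_neg (l : List E) : bary (l.map (fun x => -x)) = - bary l := by
  have : (l.map (fun x => -x)).sum = - l.sum := by
    induction l with
    | nil => simp
    | cons v l ih => simp [ih, add_comm]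
  simp [bary, this]

lemma bary_mem {K : Set E} (hK : Convex ℝ K) (l : List E) (hl : l ≠ []) (h : ∀ x ∈ l, x ∈ K) :
    bary l ∈ K := by
  induction l with
  | nil => exact absurd rfl hl
  | cons v l ih =>
    by_cases hl0 : l = []
    · subst hl0; simpa [bary] using h
    · have hb := ih hl0 (fun x hx => h x (List.mem_cons_of_mem _ hx))
      have hpos : (0 : ℝ) < l.length := by
        exact_mod_cast List.length_pos_iff.2 hl0
      have e : bary (v :: l) = ((l.length + 1 : ℝ)⁻¹) • v
          + ((l.length : ℝ) / (l.length + 1)) • bary l := by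
        simp only [bary, List.length_cons, List.sum_cons, smul_add, smul_smul]
        push_cast
        congr 2
        field_simp
      rw [e]
      exact hK (h v (by simp)) hb (by positivity) (by positivity) (by field_simp; ring)

lemma bary_dist (N : ℕ) (l : List E) (hl : l.length ≤ N + 1) (δ : ℝ) (hδ : 0 ≤ δ) (x : E) (hx : x ∈ l)
    (h : ∀ y ∈ l, dist y x ≤ δ) : dist x (bary l) ≤ (N / (N + 1) : ℝ) * δ := by
  classical
  have aux : ∀ m : List E, (∀ y ∈ m, dist y x ≤ δ) →
      ‖m.sum - (m.length : ℝ) • x‖ ≤ m.length * δ := by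
    intro m
    induction m with
    | nil => simp
    | cons y m ih =>
      intro hm
      have h1 := ih (fun z hz => hm z (List.mem_cons_of_mem _ hz))
      have h2 := hm y (by simp)
      rw [dist_eq_norm] at h2
      have : (y :: m).sum - ((y :: m).length : ℝ) • x
          = (y - x) + (m.sum - (m.length : ℝ) • x) := by
        simp only [List.sum_cons, List.length_cons]
        push_cast
        module
      rw [this]
      refine (norm_add_le _ _).trans ?_
      simp only [List.length_cons]
      push_cast
      linarith
  have hp : l.Perm (x :: l.erase x) := List.perm_cons_erase hx
  have hs : l.sum = x + (l.erase x).sum := by rw [hp.sum_eq, List.sum_cons]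
  have hlen : l.length = (l.erase x).length + 1 := by rw [hp.length_eq, List.length_cons]
  have h1 := aux (l.erase x) (fun y hy => h y (List.mem_of_mem_erase hy))
  set m := l.erase x
  have hm0 : (0 : ℝ) < m.length + 1 := by positivity
  have e : bary l - x = ((m.length + 1 : ℝ)⁻¹) • (m.sum - (m.length : ℝ) • x) := by
    have : x = ((m.length + 1 : ℝ)⁻¹) • ((m.length + 1 : ℝ) • x) := by
      rw [smul_smul, inv_mul_cancel₀ hm0.ne', one_smul]
    simp only [bary, hs, hlen]
    push_cast
    nth_rw 2 [this]
    rw [← smul_sub]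
    congr 1
    module
  rw [dist_comm, dist_eq_norm, e, norm_smul, Real.norm_of_nonneg (by positivity)]
  have hmN : (m.length : ℝ) ≤ N := by
    have : m.length ≤ N := by omega
    exact_mod_cast this
  calc (m.length + 1 : ℝ)⁻¹ * ‖m.sum - (m.length : ℝ) • x‖
      ≤ (m.length + 1 : ℝ)⁻¹ * (m.length * δ) := by gcongr
    _ = (m.length / (m.length + 1) : ℝ) * δ := by field_simp
    _ ≤ _ := by
      gcongr ?_ * δ
      rw [div_le_div_iff₀ (by positivity) (by positivity)]
      nlinarith

noncomputable def sdB : ℕ → List E → Ch E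
  | 0 => fun l => sg l
  | n + 1 => fun l => cone (bary l) (lift (sdB n) (bd (sg l)))

noncomputable def sd (n : ℕ) : Ch E →ₗ[ZMod 2] Ch E := lift (sdB n)

lemma sd_zero_sg (l : List E) : sd 0 (sg l) = sg l := by simp [sd, sdB]

lemma sd_succ_sg (n : ℕ) (l : List E) :
    sd (n + 1) (sg l) = cone (bary l) (sd n (bd (sg l))) := by simp [sd, sdB]

attribute [irreducible] sd

lemma sd_tau (n : ℕ) (c : Ch E) : sd n (tau c) = tau (sd n c) := by
  induction n generalizing c with
  | zero =>
    exact hom_ext_apply (sd 0 ∘ₗ tau) (tau ∘ₗ sd 0) (by intro l; simp [sd_zero_sg]) c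
  | succ n ih =>
    refine hom_ext_apply (sd (n + 1) ∘ₗ tau) (tau ∘ₗ sd (n + 1)) ?_ c
    intro l
    simp only [LinearMap.comp_apply, tau_sg]
    rw [sd_succ_sg, sd_succ_sg, tau_cone, bary_neg, ← ih, tau_bd, tau_sg]

lemma bd_sd (n : ℕ) (c : Ch E) (hc : c ∈ Sup (fun l => l.length = n + 1)) :
    bd (sd (n + 1) c) = sd n (bd c) := by
  induction n generalizing c with
  | zero =>
    refine eq_on_Sup (bd ∘ₗ sd (0 + 1)) (sd 0 ∘ₗ bd) ?_ hc
    intro l hl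
    obtain ⟨v, rfl⟩ := List.length_eq_one_iff.1 hl
    simp [sd_succ_sg, sd_zero_sg]
  | succ n ih =>
    refine eq_on_Sup (bd ∘ₗ sd (n + 1 + 1)) (sd (n + 1) ∘ₗ bd) ?_ hc
    intro l hl
    rw [LinearMap.comp_apply, LinearMap.comp_apply, sd_succ_sg, bd_cone, ih, bd_bd]
    · simp
    · exact Sup_mono (fun m hm => hm.1) (bd_sg_mem l (n + 1) hl)

lemma sd_mem (N : ℕ) (n : ℕ) (hn : n ≤ N + 1) (δ : ℝ) (hδ : 0 ≤ δ) (K : Set E) (hK : Convex ℝ K)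
    (l : List E) (hl : l.length = n) (hlK : ∀ x ∈ l, x ∈ K) (hd : ∀ x ∈ l, ∀ y ∈ l, dist x y ≤ δ) :
    sd n (sg l) ∈ Sup (fun m => m.length = n ∧ (∀ x ∈ m, x ∈ K) ∧
      ∀ x ∈ m, ∀ y ∈ m, dist x y ≤ (N / (N + 1) : ℝ) * δ) := by
  induction n generalizing K l with
  | zero =>
    obtain rfl : l = [] := List.length_eq_zero_iff.1 hl
    rw [sd_zero_sg]
    exact sg_mem (by simp)
  | succ n ih =>
    rw [sd_succ_sg]
    have hne : l ≠ [] := by rintro rfl; simp at hl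
    have hbK := bary_mem hK l hne hlK
    have hbd : ∀ x ∈ l, dist x (bary l) ≤ (N / (N + 1) : ℝ) * δ := fun x hx =>
      bary_dist N l (by omega) δ hδ x hx (fun y hy => hd y hy x hx)
    have hK' : Convex ℝ (K ∩ closedBall (bary l) ((N / (N + 1) : ℝ) * δ)) :=
      hK.inter (convex_closedBall _ _)
    have step : sd n (bd (sg l)) ∈ Sup (fun m => m.length = n ∧
        (∀ x ∈ m, x ∈ K ∩ closedBall (bary l) ((N / (N + 1) : ℝ) * δ)) ∧
        ∀ x ∈ m, ∀ y ∈ m, dist x y ≤ (N / (N + 1) : ℝ) * δ) := by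
      refine map_mem (sd n) _ ?_ (bd_sg_mem l n hl)
      rintro m ⟨h1, h2⟩
      exact ih (by omega) _ hK' m h1 (fun x hx => ⟨hlK x (h2 x hx), hbd x (h2 x hx)⟩)
        (fun x hx y hy => hd x (h2 x hx) y (h2 y hy))
    refine map_mem (cone (bary l)) _ ?_ step
    rintro m ⟨h1, h2, h3⟩
    rw [cone_sg]
    refine sg_mem ⟨by simp [h1], ?_, ?_⟩
    · intro x hx
      rcases List.mem_cons.1 hx with rfl | hx
      · exact hbK
      · exact (h2 x hx).1
    · intro x hx y hy
      rcases List.mem_cons.1 hx with rfl | hx <;> rcases List.mem_cons.1 hy with rfl | hy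
      · rw [dist_self]; positivity
      · rw [dist_comm]; exact (h2 y hy).2
      · exact (h2 x hx).2
      · exact h3 x hx y hy

end geom

section oct
variable {n : ℕ}

noncomputable def ev (n j : ℕ) : Fin (n + 1) → ℝ := fun i => if (i : ℕ) = j then 1 else 0

noncomputable def H (n : ℕ) : ℕ → Ch (Fin (n + 1) → ℝ)
  | 0 => sg [ev n 0]
  | k + 1 => cone (ev n (k + 1)) (H n k + tau (H n k))

lemma bd_H (k : ℕ) : bd (H n (k + 1)) = H n k + tau (H n k) := by
  have main : ∀ k, bd (H n k) + tau (bd (H n k)) = 0 ∧ bd (H n (k + 1)) = H n k + tau (H n k) := by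
    intro k
    induction k with
    | zero =>
      have h : bd (H n 0) + tau (bd (H n 0)) = 0 := by simp [H, add_self]
      refine ⟨h, ?_⟩
      rw [show H n (_ + 1) = cone _ (H n _ + tau (H n _)) from rfl, bd_cone, map_add, ← tau_bd, h]
      simp
    | succ k ih =>
      have h : bd (H n (k + 1)) + tau (bd (H n (k + 1))) = 0 := by
        rw [ih.2, map_add, tau_tau, add_comm (tau _), add_self]
      refine ⟨h, ?_⟩
      rw [show H n (_ + 1) = cone _ (H n _ + tau (H n _)) from rfl, bd_cone, map_add, ← tau_bd, h]
      simp
  exact (main k).2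

/-- closed facet of the cross-polytope -/
def facet (ε : Fin (n + 1) → ℝ) : Set (Fin (n + 1) → ℝ) :=
  {x | (∀ i, 0 ≤ ε i * x i) ∧ ∑ i, ε i * x i = 1}

def octa (n : ℕ) : Set (Fin (n + 1) → ℝ) := {x | ∑ i, |x i| = 1}

lemma convex_facet (ε : Fin (n + 1) → ℝ) : Convex ℝ (facet ε) := by
  rintro x ⟨hx1, hx2⟩ y ⟨hy1, hy2⟩ a b ha hb hab
  refine ⟨fun i => ?_, ?_⟩
  · have := mul_nonneg ha (hx1 i)
    have := mul_nonneg hb (hy1 i)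
    simp only [Pi.add_apply, Pi.smul_apply, smul_eq_mul]
    nlinarith
  · have : ∑ i, ε i * (a • x + b • y) i = a * ∑ i, ε i * x i + b * ∑ i, ε i * y i := by
      rw [Finset.mul_sum, Finset.mul_sum, ← Finset.sum_add_distrib]
      refine Finset.sum_congr rfl fun i _ => ?_
      simp only [Pi.add_apply, Pi.smul_apply, smul_eq_mul]; ring
    rw [this, hx2, hy2]; linarith

lemma facet_sub (ε : Fin (n + 1) → ℝ) (hε : ∀ i, |ε i| = 1) : facet ε ⊆ octa n := by
  rintro x ⟨h1, h2⟩
  simp only [octa, Set.mem_ofPred_eq]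
  rw [← h2]
  refine Finset.sum_congr rfl fun i _ => ?_
  rw [← abs_of_nonneg (h1 i), abs_mul, hε, one_mul]

lemma H_mem (k : ℕ) : H n k ∈ Sup (fun l => l.length = k + 1 ∧ ∃ ε : ℕ → ℝ,
    (∀ i, |ε i| = 1) ∧ ∀ x ∈ l, ∃ j ≤ k, x = ε j • ev n j) := by
  induction k with
  | zero => exact sg_mem ⟨rfl, fun _ => 1, by simp, by simp⟩
  | succ k ih =>
    have ht : tau (H n k) ∈ Sup (fun l => l.length = k + 1 ∧ ∃ ε : ℕ → ℝ,
        (∀ i, |ε i| = 1) ∧ ∀ x ∈ l, ∃ j ≤ k, x = ε j • ev n j) := by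
      refine map_mem tau _ ?_ ih
      rintro l ⟨h1, ε, h2, h3⟩
      rw [tau_sg]
      refine sg_mem ⟨by simpa using h1, fun i => - ε i, by simpa using h2, ?_⟩
      intro x hx
      obtain ⟨y, hy, rfl⟩ := List.mem_map.1 hx
      obtain ⟨j, hj, rfl⟩ := h3 y hy
      exact ⟨j, hj, by simp⟩
    refine map_mem (cone (ev n (k + 1))) _ ?_ (Submodule.add_mem _ ih ht)
    rintro l ⟨h1, ε, h2, h3⟩
    rw [cone_sg]
    refine sg_mem ⟨by simp [h1], Function.update ε (k + 1) 1, ?_, ?_⟩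
    · intro i
      by_cases hi : i = k + 1
      · subst hi; simp
      · simp [Function.update_of_ne hi, h2]
    · intro x hx
      rcases List.mem_cons.1 hx with rfl | hx
      · exact ⟨k + 1, le_rfl, by simp⟩
      · obtain ⟨j, hj, rfl⟩ := h3 x hx
        exact ⟨j, by omega, by rw [Function.update_of_ne (by omega)]⟩

lemma ev_facet (ε : ℕ → ℝ) (hε : ∀ i, |ε i| = 1) (j : ℕ) (hj : j ≤ n) :
    ε j • ev n j ∈ facet (fun i : Fin (n + 1) => ε i) := by
  have h1 : ∀ i, ε i * ε i = 1 := fun i => by rw [← abs_mul_abs_self, hε, one_mul]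
  have h2 : ∀ i : Fin (n + 1), ε i * (ε j • ev n j) i = if i = ⟨j, by omega⟩ then 1 else 0 := by
    intro i
    by_cases hi : (i : ℕ) = j
    · have : i = ⟨j, by omega⟩ := Fin.ext hi
      simp [ev, hi, h1, this]
    · have : i ≠ ⟨j, by omega⟩ := fun h => hi (by rw [h])
      simp [ev, hi, this]
  refine ⟨fun i => ?_, ?_⟩
  · rw [h2]; split_ifs <;> norm_num
  · rw [Finset.sum_congr rfl fun i _ => h2 i]; simp

lemma octa_coord {x : Fin (n + 1) → ℝ} (hx : x ∈ octa n) (i : Fin (n + 1)) : |x i| ≤ 1 := by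
  rw [← show ∑ i, |x i| = 1 from hx]
  exact Finset.single_le_sum (f := fun i => |x i|) (fun i _ => abs_nonneg _) (Finset.mem_univ i)

lemma octa_norm {x : Fin (n + 1) → ℝ} (hx : x ∈ octa n) : ‖x‖ ≤ 1 :=
  (pi_norm_le_iff_of_nonneg zero_le_one).2 fun i => octa_coord hx i

noncomputable def G (n m k : ℕ) : Ch (Fin (n + 1) → ℝ) := (sd (k + 1))^[m] (H n k)

lemma G_mem (m k : ℕ) (hk : k ≤ n) : G n m k ∈ Sup (fun l => l.length = k + 1 ∧
    ∃ ε : Fin (n + 1) → ℝ, (∀ i, |ε i| = 1) ∧ (∀ x ∈ l, x ∈ facet ε) ∧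
      ∀ x ∈ l, ∀ y ∈ l, dist x y ≤ (n / (n + 1) : ℝ) ^ m * 2) := by
  induction m with
  | zero =>
    refine Sup_mono ?_ (H_mem k)
    rintro l ⟨h1, ε, h2, h3⟩
    have h4 : ∀ x ∈ l, x ∈ facet (fun i : Fin (n + 1) => ε i) := by
      intro x hx
      obtain ⟨j, hj, rfl⟩ := h3 x hx
      exact ev_facet ε h2 j (by omega)
    refine ⟨h1, fun i => ε i, fun i => h2 i, h4, ?_⟩
    intro x hx y hy
    have hx' := octa_norm (facet_sub _ (fun i => h2 i) (h4 x hx))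
    have hy' := octa_norm (facet_sub _ (fun i => h2 i) (h4 y hy))
    rw [pow_zero, one_mul, dist_eq_norm]
    linarith [norm_sub_le x y]
  | succ m ih =>
    rw [G, Function.iterate_succ_apply']
    refine map_mem (sd (k + 1)) _ ?_ ih
    rintro l ⟨h1, ε, h2, h3, h4⟩
    refine Sup_mono ?_ (sd_mem n (k + 1) (by omega) _ (by positivity) (facet ε) (convex_facet ε)
      l h1 h3 h4)
    rintro l' ⟨g1, g2, g3⟩
    refine ⟨g1, ε, h2, g2, fun x hx y hy => (g3 x hx y hy).trans (le_of_eq ?_)⟩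
    ring

lemma bd_G (m k : ℕ) (hk : k < n) : bd (G n m (k + 1)) = G n m k + tau (G n m k) := by
  induction m with
  | zero => exact bd_H k
  | succ m ih =>
    have e : ∀ j, G n (m + 1) j = sd (j + 1) (G n m j) := fun j => by
      rw [G, Function.iterate_succ_apply']; rfl
    rw [e, e, bd_sd, ih, map_add, sd_tau]
    exact Sup_mono (fun l hl => hl.1) (G_mem m (k + 1) hk)

lemma G_zero (m : ℕ) : ∃ v, G n m 0 = sg [v] := by
  induction m with
  | zero => exact ⟨_, rfl⟩
  | succ m ih =>
    obtain ⟨v, hv⟩ := ih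
    refine ⟨bary [v], ?_⟩
    have : G n (m + 1) 0 = sd 1 (G n m 0) := by rw [G, Function.iterate_succ_apply']; rfl
    rw [this, hv, sd_succ_sg]
    simp [sd_zero_sg]

lemma isCompact_octa : IsCompact (octa n) := by
  apply Metric.isCompact_of_isClosed_isBounded
  · exact isClosed_eq (by fun_prop) continuous_const
  · refine (Metric.isBounded_closedBall (x := (0 : Fin (n + 1) → ℝ)) (r := 1)).subset ?_
    intro x hx
    simpa using octa_norm hx

lemma octa_neg {x : Fin (n + 1) → ℝ} (hx : x ∈ octa n) : -x ∈ octa n := by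
  simpa [octa] using hx

lemma octa_ne {x : Fin (n + 1) → ℝ} (hx : x ∈ octa n) : x ≠ 0 := by
  rintro rfl; simp [octa] at hx

lemma exists_sign (n : ℕ) : ∃ r : (Fin (n + 1) → ℝ) → Prop, ∀ x, x ≠ 0 → (r (-x) ↔ ¬ r x) := by
  refine ⟨fun x => 0 < toLex x, fun x hx => ?_⟩
  have hx' : toLex x ≠ 0 := fun h => hx (toLex.injective h)
  show 0 < toLex (-x) ↔ ¬ 0 < toLex x
  rw [toLex_neg, neg_pos]
  refine ⟨fun h => lt_asymm h, fun h => ?_⟩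
  rcases lt_trichotomy (toLex x) 0 with h' | h' | h'
  · exact h'
  · exact absurd h' hx'
  · exact absurd h' h

/-- Borsuk–Ulam for odd maps on the cross-polytope boundary. -/
theorem octa_zero (F : (Fin (n + 1) → ℝ) → (Fin n → ℝ)) (hF : ContinuousOn F (octa n))
    (hodd : ∀ x ∈ octa n, F (-x) = - F x) : ∃ x ∈ octa n, F x = 0 := by
  classical
  by_contra! hne
  obtain ⟨η, hη, hlow⟩ : ∃ η > 0, ∀ x ∈ octa n, η ≤ ‖F x‖ := by
    have hnonempty : (octa n).Nonempty :=
      ⟨_, facet_sub (fun _ => 1) (by simp) (ev_facet (n := n) (fun _ => 1) (by simp) 0 (by omega))⟩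
    obtain ⟨x0, hx0, hmin⟩ := isCompact_octa.exists_isMinOn hnonempty hF.norm
    exact ⟨‖F x0‖, norm_pos_iff.2 (hne x0 hx0), fun x hx => hmin hx⟩
  obtain ⟨δ, hδ, huc⟩ := Metric.uniformContinuousOn_iff.1
    (isCompact_octa.uniformContinuousOn_of_continuous hF) η hη
  obtain ⟨r, hr⟩ := exists_sign n
  let f : ℕ → (Fin (n + 1) → ℝ) → ℝ := fun i x => if h : i < n then F x ⟨i, h⟩ else 0
  have hf : ∀ i, ∀ x ∈ octa n, f i (-x) = - f i x := by
    intro i x hx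
    by_cases h : i < n <;> simp [f, h, hodd x hx]
  let s : ℕ → (Fin (n + 1) → ℝ) → ZMod 2 :=
    fun i x => if 0 < f i x ∨ (f i x = 0 ∧ r x) then 1 else 0
  have hs : ∀ x ∈ octa n, ∀ i, s i (-x) = s i x + 1 := by
    intro x hx i
    have h1 := hr x (octa_ne hx)
    have h11 : (1 : ZMod 2) + 1 = 0 := by decide
    simp only [s, hf i x hx, h1]
    rcases lt_trichotomy (f i x) 0 with h | h | h
    · simp [h, h.ne, not_lt.2 h.le]
    · by_cases hrx : r x <;> simp [h, hrx, h11]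
    · simp [h, h.ne', not_lt.2 h.le, h11]
  obtain ⟨m, hm⟩ : ∃ m : ℕ, (n / (n + 1) : ℝ) ^ m < δ / 2 :=
    exists_pow_lt_of_lt_one (by positivity) (by rw [div_lt_one (by positivity)]; linarith)
  obtain ⟨v, hv⟩ := G_zero (n := n) m
  have hG : lift (Om s) (G n m n) = 1 := by
    refine Om_chain s (octa n) hs n (G n m) v hv (fun k hk => bd_G m k hk) ?_ n le_rfl
    intro k hk
    refine Sup_mono ?_ (G_mem m k hk)
    rintro l ⟨h1, ε, h2, h3, -⟩
    exact ⟨h1, fun x hx => facet_sub ε h2 (h3 x hx)⟩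
  have hG0 : lift (Om s) (G n m n) = 0 := by
    refine eq_on_Sup (lift (Om s)) 0 ?_ (G_mem m n le_rfl)
    rintro l ⟨h1, ε, h2, h3, h4⟩
    by_contra hcon
    rw [lift_sg, LinearMap.zero_apply] at hcon
    have hl : l ≠ [] := by rintro rfl; simp at h1
    obtain ⟨x0, hx0⟩ := List.exists_mem_of_ne_nil l hl
    have hX : ∀ x ∈ l, x ∈ octa n := fun x hx => facet_sub ε h2 (h3 x hx)
    obtain ⟨i, hi⟩ : ∃ i, η ≤ |F x0 i| := by
      by_contra! hall
      exact absurd (hlow x0 (hX x0 hx0)) (not_le.2 ((pi_norm_lt_iff hη).2 hall))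
    have hclose : ∀ x ∈ l, |F x i - F x0 i| < η := by
      intro x hx
      have hd : dist x x0 < δ := lt_of_le_of_lt (h4 x hx x0 hx0) (by linarith)
      exact lt_of_le_of_lt (dist_le_pi_dist (F x) (F x0) i) (huc x (hX x hx) x0 (hX x0 hx0) hd)
    have hconst : ∀ x ∈ l, s i x = s i x0 := by
      intro x hx
      have hfx : ∀ y, f i y = F y i := fun y => by simp [f]
      have hc := abs_lt.1 (hclose x hx)
      simp only [s, hfx]
      rcases le_abs.1 hi with h | h
      · have : 0 < F x i := by linarith
        have : 0 < F x0 i := by linarith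
        simp [*]
      · have a : F x i < 0 := by linarith
        have b : F x0 i < 0 := by linarith
        simp [a.ne, b.ne, not_lt.2 a.le, not_lt.2 b.le]
    obtain ⟨x, hx, y, hy, hxy⟩ := Om_ne s l hcon i (by rw [h1]; omega)
    exact hxy ((hconst x hx).trans (hconst y hy).symm)
  rw [hG] at hG0
  exact one_ne_zero hG0

/-- Borsuk–Ulam on the Euclidean sphere. -/
theorem borsuk_ulam (n : ℕ) (f : EuclideanSpace ℝ (Fin (n + 1)) → EuclideanSpace ℝ (Fin n))
    (hf : ContinuousOn f (sphere 0 1)) : ∃ y ∈ sphere (0 : EuclideanSpace ℝ (Fin (n + 1))) 1,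
      f y = f (-y) := by
  let p : (Fin (n + 1) → ℝ) → EuclideanSpace ℝ (Fin (n + 1)) :=
    fun x => (‖WithLp.toLp 2 x‖⁻¹ : ℝ) • WithLp.toLp 2 x
  have hne : ∀ x ∈ octa n, ‖WithLp.toLp 2 x‖ ≠ 0 := by
    intro x hx h
    apply octa_ne hx
    have := norm_eq_zero.1 h
    simpa using this
  have hp : ∀ x ∈ octa n, p x ∈ sphere (0 : EuclideanSpace ℝ (Fin (n + 1))) 1 := by
    intro x hx
    simp only [p, mem_sphere_zero_iff_norm, norm_smul, norm_inv, norm_norm]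
    exact inv_mul_cancel₀ (hne x hx)
  have hpn : ∀ x, p (-x) = - p x := by
    intro x; simp [p]
  have hpc : ContinuousOn p (octa n) := by
    have hc : Continuous fun x : Fin (n + 1) → ℝ => WithLp.toLp 2 x := by fun_prop
    exact (hc.norm.continuousOn.inv₀ hne).smul hc.continuousOn
  have h1 : ContinuousOn (fun x => f (p x)) (octa n) := hf.comp hpc hp
  have h2 : ContinuousOn (fun x => f (- p x)) (octa n) :=
    hf.comp hpc.neg (fun x hx => by simpa using hp x hx)
  obtain ⟨x, hx, h⟩ := octa_zero (fun x => WithLp.ofLp (f (p x) - f (- p x)))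
    (by
      have hc : Continuous fun x : EuclideanSpace ℝ (Fin n) => WithLp.ofLp x := by fun_prop
      exact hc.comp_continuousOn (h1.sub h2))
    (by intro x _; simp [hpn])
  refine ⟨p x, hp x hx, ?_⟩
  rw [← sub_eq_zero]
  exact (WithLp.ofLp_injective 2) h

end oct

end BU

/-- Borsuk–Ulam obstruction: for each time `t` there is a point `y_t` on the sphere such
that for one of the antipodal targets `g(±y_t)` the loss at time `t` is at least `l²/8`. -/
theorem borsuk_ulam_loss_lower_bound (W d : ℕ)
    (Φ : EuclideanSpace ℝ (Fin W) → EuclideanSpace ℝ (Fin d))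
    (wf : EuclideanSpace ℝ (Fin d) → ℝ → EuclideanSpace ℝ (Fin W))
    (hw0 : ∀ f, wf f 0 = 0)
    (hflow : ∀ f, ∀ t ≥ (0 : ℝ), HasDerivAt (wf f) (-(gradient (loss Φ f) (wf f t))) t)
    (hcont : ∀ t : ℝ, Continuous fun f => wf f t)
    (g : EuclideanSpace ℝ (Fin (W + 1)) → EuclideanSpace ℝ (Fin d))
    (hg : ContinuousOn g (sphere (0 : EuclideanSpace ℝ (Fin (W + 1))) 1))
    (hinj : Set.InjOn g (sphere (0 : EuclideanSpace ℝ (Fin (W + 1))) 1))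
    (l : ℝ) (hl : 0 < l)
    (hsep : ∀ y ∈ sphere (0 : EuclideanSpace ℝ (Fin (W + 1))) 1, l ≤ ‖g y - g (-y)‖) :
    ∀ t ≥ (0 : ℝ), ∃ y ∈ sphere (0 : EuclideanSpace ℝ (Fin (W + 1))) 1,
      l ^ 2 / 8 ≤ max (loss Φ (g y) (wf (g y) t)) (loss Φ (g (-y)) (wf (g (-y)) t)) := by
  intro t _
  have hc : ContinuousOn (fun y => wf (g y) t)
      (sphere (0 : EuclideanSpace ℝ (Fin (W + 1))) 1) := (hcont t).comp_continuousOn hg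
  obtain ⟨y, hy, hz⟩ := BU.borsuk_ulam W (fun y => wf (g y) t) hc
  refine ⟨y, hy, ?_⟩
  have hs := hsep y hy
  simp only [loss]
  rw [← hz]
  set z := Φ (wf (g y) t)
  have htri : ‖g y - g (-y)‖ ≤ ‖g y - z‖ + ‖g (-y) - z‖ := by
    rw [norm_sub_rev (g (-y)) z]
    exact norm_sub_le_norm_sub_add_norm_sub _ _ _
  have h1 := norm_nonneg (g y - z)
  have h2 := norm_nonneg (g (-y) - z)
  rcases le_total (l / 2) ‖g y - z‖ with h | h
  · refine le_max_of_le_left ?_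
    nlinarith
  · refine le_max_of_le_right ?_
    have : l / 2 ≤ ‖g (-y) - z‖ := by linarith
    nlinarith
end

section
/- Let Φ : ℝ^W → ℝ^d be C¹ with Lipschitz differential, with learnable set F_Φ, and let g : S^W → ℝ^d be continuous and injective. Then the image G = g(S^W) is not contained in F_Φ; that is, G contains a non-learnable target. -/
open MeasureTheory Filter Topology Set Metric

/-- The set of targets learnable by gradient flow started at `0`. -/
def learnableSet {W d : ℕ} (Φ : EuclideanSpace ℝ (Fin W) → EuclideanSpace ℝ (Fin d)) :
    Set (EuclideanSpace ℝ (Fin d)) :=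
  {f | ∃ w : ℝ → EuclideanSpace ℝ (Fin W), w 0 = 0 ∧
    (∀ t ≥ (0 : ℝ), HasDerivAt w (-(gradient (loss Φ f) (w t))) t) ∧
    (⨅ t : Set.Ici (0 : ℝ), loss Φ f (w t)) = 0}


section degree
variable {E : Type*} [NormedAddCommGroup E] [InnerProductSpace ℝ E] [FiniteDimensional ℝ E]

theorem aux_poly (u : E → E) (hu : ContDiff ℝ 1 u) (M : ℝ) (k : ℕ) :
    ∃ p : Polynomial C(E, ℝ), ∀ (t : ℝ) (x : E),
      Polynomial.eval₂ (ContinuousMap.evalAlgHom ℝ ℝ x : C(E, ℝ) →+* ℝ) t p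
        = (M ^ 2 - ‖x + t • u x‖ ^ 2) ^ k *
          (ContinuousLinearMap.id ℝ E + t • fderiv ℝ u x).det := by
  classical
  let b := Module.finBasis ℝ E
  have hd : Continuous (fderiv ℝ u) := hu.continuous_fderiv (by norm_num)
  have huc := hu.continuous
  let c : Fin (Module.finrank ℝ E) → Fin (Module.finrank ℝ E) → C(E, ℝ) := fun i j =>
    ⟨fun x => b.repr (fderiv ℝ u x (b j)) i, by
      have : Continuous fun v : E => b.repr v i :=
        (LinearMap.continuous_of_finiteDimensional (b.coord i))
      exact this.comp (hd.clm_apply continuous_const)⟩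
  let A : Matrix (Fin (Module.finrank ℝ E)) (Fin (Module.finrank ℝ E)) (Polynomial C(E, ℝ)) :=
    fun i j => (if i = j then 1 else 0) + Polynomial.X * Polynomial.C (c i j)
  let q : Polynomial C(E, ℝ) :=
    Polynomial.C ⟨fun x => M ^ 2 - ‖x‖ ^ 2, by fun_prop⟩
      - Polynomial.X * Polynomial.C ⟨fun x => 2 * inner ℝ x (u x), by fun_prop⟩
      - Polynomial.X ^ 2 * Polynomial.C ⟨fun x => ‖u x‖ ^ 2, by fun_prop⟩
  refine ⟨q ^ k * A.det, fun t x => ?_⟩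
  set φ : Polynomial C(E, ℝ) →+* ℝ :=
    Polynomial.eval₂RingHom (ContinuousMap.evalAlgHom ℝ ℝ x : C(E, ℝ) →+* ℝ) t with hφ
  have h1 : φ q = M ^ 2 - ‖x + t • u x‖ ^ 2 := by
    rw [norm_add_sq_real, norm_smul, inner_smul_right, mul_pow, Real.norm_eq_abs, sq_abs]
    simp only [q, hφ, map_sub, map_mul, map_pow, Polynomial.coe_eval₂RingHom, Polynomial.eval₂_C,
      Polynomial.eval₂_X]
    simp
    ring
  have h2 : φ A.det = (ContinuousLinearMap.id ℝ E + t • fderiv ℝ u x).det := by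
    rw [RingHom.map_det, ContinuousLinearMap.det, ← LinearMap.det_toMatrix b]
    congr 1
    ext i j
    rw [LinearMap.toMatrix_apply]
    change φ ((if i = j then 1 else 0) + Polynomial.X * Polynomial.C (c i j)) = _
    by_cases hij : i = j
    · subst hij
      simp [hφ, c, mul_comm t]
    · simp [hφ, c, hij, Finsupp.single_apply, Ne.symm hij, mul_comm t]
  change φ (q ^ k * A.det) = _
  rw [map_mul, map_pow, h1, h2]

theorem aux_integral_poly [MeasurableSpace E] [BorelSpace E] (p : Polynomial C(E, ℝ))
    (μ : Measure E) [IsFiniteMeasureOnCompacts μ] :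
    ∃ J : Polynomial ℝ, ∀ t : ℝ, J.eval t = ∫ x in ball (0 : E) 2,
      Polynomial.eval₂ (ContinuousMap.evalAlgHom ℝ ℝ x : C(E, ℝ) →+* ℝ) t p ∂μ := by
  refine ⟨∑ i ∈ Finset.range (p.natDegree + 1),
    Polynomial.C (∫ x in ball (0 : E) 2, p.coeff i x ∂μ) * Polynomial.X ^ i, fun t => ?_⟩
  simp only [Polynomial.eval₂_eq_sum_range, Polynomial.eval_finsetSum, Polynomial.eval_mul,
    Polynomial.eval_C, Polynomial.eval_pow, Polynomial.eval_X]
  rw [integral_finsetSum]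
  · refine Finset.sum_congr rfl fun i _ => ?_
    rw [integral_mul_const]
    rfl
  · intro i _
    have : Continuous fun x => p.coeff i x * t ^ i := by fun_prop
    exact (this.continuousOn.integrableOn_compact (isCompact_closedBall (0:E) 2)).mono_set
      ball_subset_closedBall

theorem aux_small [MeasurableSpace E] [BorelSpace E] (u : E → E) (hu : ContDiff ℝ 1 u)
    (h0 : ∀ x, 2 ≤ ‖x‖ → u x = 0) (μ : Measure E) [μ.IsAddHaarMeasure] :
    ∃ ε > 0, ∀ t ∈ Ioo (0 : ℝ) ε, ∀ φ : E → ℝ,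
      ∫ x in ball (0 : E) 2, φ (x + t • u x) *
          (ContinuousLinearMap.id ℝ E + t • fderiv ℝ u x).det ∂μ
        = ∫ x in ball (0 : E) 2, φ x ∂μ := by
  have hd : Continuous (fderiv ℝ u) := hu.continuous_fderiv (by norm_num)
  have hcs : HasCompactSupport u := by
    apply HasCompactSupport.of_support_subset_isCompact (isCompact_closedBall (0 : E) 2)
    intro x hx
    rw [mem_closedBall_zero_iff]
    by_contra h
    exact hx (h0 x (by linarith))
  obtain ⟨C, hC⟩ := ContDiff.lipschitzWith_of_hasCompactSupport hcs hu (by norm_num)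
  have hpos : ∀ᶠ t in 𝓝 (0 : ℝ), ∀ x ∈ closedBall (0 : E) 2,
      0 < (ContinuousLinearMap.id ℝ E + t • fderiv ℝ u x).det := by
    apply (isCompact_closedBall (0 : E) 2).eventually_forall_of_forall_eventually
    intro x _
    have hc : Continuous fun z : ℝ × E =>
        (ContinuousLinearMap.id ℝ E + z.1 • fderiv ℝ u z.2).det := by
      apply ContinuousLinearMap.continuous_det.comp
      fun_prop
    apply hc.continuousAt.eventually_const_lt
    simp [ContinuousLinearMap.det]
  obtain ⟨ε₁, hε₁, H⟩ := Metric.eventually_nhds_iff.1 hpos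
  refine ⟨min ε₁ (1 / (2 * (C + 1))), by positivity, fun t ht φ => ?_⟩
  obtain ⟨ht0, ht1⟩ := ht
  have hdet := H (y := t) (by rw [Real.dist_0_eq_abs, abs_of_pos ht0]; exact lt_of_lt_of_le ht1 (min_le_left _ _))
  have htC : t * C ≤ 1 / 2 := by
    have : t < 1 / (2 * (C + 1)) := lt_of_lt_of_le ht1 (min_le_right _ _)
    rw [lt_div_iff₀ (by positivity)] at this
    nlinarith
  have hl : ∀ x y, ‖t • u x - t • u y‖ ≤ 1 / 2 * ‖x - y‖ := by
    intro x y
    rw [← smul_sub, norm_smul, Real.norm_of_nonneg ht0.le]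
    have := hC.norm_sub_le x y
    nlinarith [norm_nonneg (x - y)]
  have hinj : Function.Injective fun x => x + t • u x := by
    intro x y hxy
    have h2 := hl x y
    have h3 : t • u x - t • u y = y - x := by
      rw [sub_eq_sub_iff_add_eq_add, add_comm, add_comm y]; simpa [add_comm] using hxy
    rw [h3, norm_sub_rev] at h2
    have : ‖x - y‖ = 0 := by linarith [norm_nonneg (x - y)]
    exact sub_eq_zero.1 (norm_eq_zero.1 this)
  have hsurj : Function.Surjective fun x => x + t • u x := by
    intro y
    have hcon : ContractingWith (1 / 2) fun x => y - t • u x := by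
      refine ⟨by rw [← NNReal.coe_lt_coe]; norm_num, LipschitzWith.of_dist_le_mul fun a b => ?_⟩
      rw [dist_eq_norm, dist_eq_norm]
      have := hl b a
      rw [norm_sub_rev b a] at this
      simpa using this
    refine ⟨hcon.fixedPoint, ?_⟩
    have := hcon.fixedPoint_isFixedPt
    have h2 : y - t • u hcon.fixedPoint = hcon.fixedPoint := this
    change hcon.fixedPoint + t • u hcon.fixedPoint = y
    nth_rewrite 1 [← h2]
    simp
  have him : (fun x => x + t • u x) '' ball (0 : E) 2 = ball (0 : E) 2 := by
    ext y
    simp only [mem_image, mem_ball_zero_iff]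
    constructor
    · rintro ⟨x, hx, rfl⟩
      by_contra h
      push Not at h
      have := h0 _ h
      have h5 : x + t • u x = x := hinj (by simp [this])
      rw [h5] at h
      linarith
    · intro hy
      obtain ⟨x, rfl⟩ := hsurj y
      refine ⟨x, ?_, rfl⟩
      by_contra h
      push Not at h
      simp only [h0 x h, smul_zero, add_zero] at hy
      linarith
  have key := integral_image_eq_integral_abs_det_fderiv_smul μ (s := ball (0 : E) 2)
    (f := fun x => x + t • u x) (f' := fun x => ContinuousLinearMap.id ℝ E + t • fderiv ℝ u x)
    measurableSet_ball (fun x _ => ((hasFDerivAt_id x).add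
      (((hu.differentiable (by norm_num)) x).hasFDerivAt.const_smul t)).hasFDerivWithinAt)
    hinj.injOn φ
  rw [him] at key
  rw [key]
  refine setIntegral_congr_fun measurableSet_ball fun x hx => ?_
  simp only [smul_eq_mul]
  rw [abs_of_pos (hdet x (ball_subset_closedBall hx)), mul_comm]

theorem aux_degree [MeasurableSpace E] [BorelSpace E] (u : E → E) (hu : ContDiff ℝ 1 u)
    (h0 : ∀ x, 2 ≤ ‖x‖ → u x = 0)
    (hG : ∀ x, ‖x‖ < 2 → (ContinuousLinearMap.id ℝ E + fderiv ℝ u x).det = 0 ∨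
      1 / 2 ≤ ‖x + u x‖) : False := by
  let μ : Measure E := volume
  have hd : Continuous (fderiv ℝ u) := hu.continuous_fderiv (by norm_num)
  have huc := hu.continuous
  have hdc : Continuous fun x : E => (ContinuousLinearMap.id ℝ E + fderiv ℝ u x).det := by
    apply ContinuousLinearMap.continuous_det.comp
    fun_prop
  obtain ⟨ε, hε, hsmall⟩ := aux_small u hu h0 μ
  obtain ⟨M₀, hM₀⟩ := (isCompact_closedBall (0 : E) 2).exists_bound_of_continuousOn
    (f := fun x => x + u x) (by fun_prop)
  obtain ⟨D, hD⟩ := (isCompact_closedBall (0 : E) 2).exists_bound_of_continuousOn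
    hdc.continuousOn
  set M := max M₀ 2 with hM
  have hM2 : 2 ≤ M := le_max_right _ _
  have hMM : ∀ x ∈ closedBall (0 : E) 2, ‖x + u x‖ ≤ M := fun x hx =>
    (hM₀ x hx).trans (le_max_left _ _)
  have hDn : 0 ≤ D := (norm_nonneg _).trans (hD 0 (by simp))
  have hfin : ∀ r, μ (ball (0 : E) r) ≠ ⊤ := fun r => measure_ball_lt_top.ne
  have main : ∀ k : ℕ, ∫ x in ball (0 : E) 2, (M ^ 2 - ‖x + u x‖ ^ 2) ^ k *
          (ContinuousLinearMap.id ℝ E + fderiv ℝ u x).det ∂μ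
        = ∫ x in ball (0 : E) 2, (M ^ 2 - ‖x‖ ^ 2) ^ k ∂μ := by
    intro k
    obtain ⟨p, hp⟩ := aux_poly u hu M k
    obtain ⟨J, hJ⟩ := aux_integral_poly p μ
    have hJ' : J = Polynomial.C (∫ x in ball (0 : E) 2, (M ^ 2 - ‖x‖ ^ 2) ^ k ∂μ) := by
      apply Polynomial.eq_of_infinite_eval_eq
      apply (Set.Ioo_infinite hε).mono
      intro t ht
      simp only [mem_ofPred_eq, hJ, hp, Polynomial.eval_C]
      exact hsmall t ht fun z => (M ^ 2 - ‖z‖ ^ 2) ^ k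
    have := hJ 1
    rw [hJ'] at this
    simpa [hp] using this.symm
  have upper : ∀ k : ℕ, ∫ x in ball (0 : E) 2, (M ^ 2 - ‖x‖ ^ 2) ^ k ∂μ
      ≤ (M ^ 2 - 1 / 4) ^ k * D * μ.real (ball (0 : E) 2) := by
    intro k
    rw [← main]
    refine (le_abs_self _).trans ?_
    rw [← Real.norm_eq_abs]
    refine norm_setIntegral_le_of_norm_le_const (hfin 2).lt_top fun x hx => ?_
    have hx' := ball_subset_closedBall hx
    have hb := hMM x hx'
    rw [norm_mul, norm_pow]
    rcases hG x (by simpa using hx) with h | h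
    · rw [h]
      simp only [norm_zero, mul_zero]
      have : 0 ≤ M ^ 2 - 1 / 4 := by nlinarith
      positivity
    · have h1 : ‖M ^ 2 - ‖x + u x‖ ^ 2‖ ≤ M ^ 2 - 1 / 4 := by
        rw [Real.norm_of_nonneg (by nlinarith)]
        nlinarith
      have h2 : 0 ≤ M ^ 2 - 1 / 4 := by nlinarith
      exact mul_le_mul (pow_le_pow_left₀ (norm_nonneg _) h1 k) (hD x hx') (norm_nonneg _)
        (pow_nonneg h2 k)
  have lower : ∀ k : ℕ, (M ^ 2 - 1 / 16) ^ k * μ.real (ball (0 : E) (1 / 4))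
      ≤ ∫ x in ball (0 : E) 2, (M ^ 2 - ‖x‖ ^ 2) ^ k ∂μ := by
    intro k
    have hcont : Continuous fun x : E => (M ^ 2 - ‖x‖ ^ 2) ^ k := by fun_prop
    have hint : IntegrableOn (fun x : E => (M ^ 2 - ‖x‖ ^ 2) ^ k) (ball (0 : E) 2) μ :=
      (hcont.continuousOn.integrableOn_compact (isCompact_closedBall (0:E) 2)).mono_set
        ball_subset_closedBall
    have hsub : ball (0 : E) (1 / 4) ⊆ ball 0 2 := ball_subset_ball (by norm_num)
    calc (M ^ 2 - 1 / 16) ^ k * μ.real (ball (0 : E) (1 / 4))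
        = ∫ x in ball (0 : E) (1 / 4), (M ^ 2 - 1 / 16) ^ k ∂μ := by
          rw [setIntegral_const, smul_eq_mul, mul_comm]
      _ ≤ ∫ x in ball (0 : E) (1 / 4), (M ^ 2 - ‖x‖ ^ 2) ^ k ∂μ := by
          refine setIntegral_mono_on (integrableOn_const (hfin _)) (hint.mono_set hsub)
            measurableSet_ball fun x hx => ?_
          have hx : ‖x‖ < 1 / 4 := by simpa using hx
          have : 0 ≤ M ^ 2 - 1 / 16 := by nlinarith
          gcongr
          nlinarith [norm_nonneg x]
      _ ≤ _ := by
          refine setIntegral_mono_set hint ?_ (Eventually.of_forall hsub)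
          refine (ae_restrict_iff' measurableSet_ball).2 (Eventually.of_forall fun x hx => ?_)
          have hx : ‖x‖ < 2 := by simpa using hx
          have : 0 ≤ M ^ 2 - ‖x‖ ^ 2 := by nlinarith [norm_nonneg x]
          simp only [Pi.zero_apply]
          positivity
  have hv : 0 < μ.real (ball (0 : E) (1 / 4)) :=
    ENNReal.toReal_pos (measure_ball_pos μ _ (by norm_num)).ne' (hfin _)
  set a := M ^ 2 - 1 / 16 with ha
  set b := M ^ 2 - 1 / 4 with hb
  have hb0 : 0 < b := by nlinarith
  have hab : 1 < a / b := by rw [one_lt_div hb0]; linarith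
  obtain ⟨k, hk⟩ := pow_unbounded_of_one_lt
    (D * μ.real (ball (0 : E) 2) / μ.real (ball (0 : E) (1 / 4))) hab
  rw [div_pow, div_lt_div_iff₀ hv (by positivity)] at hk
  have := (lower k).trans (upper k)
  nlinarith

end degree
theorem aux_no_factor {W : ℕ} (h : EuclideanSpace ℝ (Fin (W + 1)) → EuclideanSpace ℝ (Fin W))
    (Q : EuclideanSpace ℝ (Fin W) → EuclideanSpace ℝ (Fin (W + 1)))
    (hh : ContDiff ℝ 1 h) (hQ : ContDiff ℝ 1 Q)
    (H : ∀ x, 1 ≤ ‖x‖ → ‖x‖ ≤ 2 → ‖Q (h x) - (‖x‖)⁻¹ • x‖ ≤ 1 / 2) : False := by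
  let χ : ContDiffBump (0 : EuclideanSpace ℝ (Fin (W + 1))) := ⟨1, 2, by norm_num, by norm_num⟩
  have hF : ContDiff ℝ 1 (fun x => Q (h x)) := hQ.comp hh
  have hχ : ContDiff ℝ 1 χ := χ.contDiff
  refine aux_degree (fun x => χ x • (Q (h x) - x)) (hχ.smul (hF.sub contDiff_id)) ?_ ?_
  · intro x hx
    have : χ x = 0 := χ.zero_of_le_dist (by simpa using hx)
    simp [this]
  · intro x hx
    by_cases h1 : ‖x‖ < 1
    · left
      have hev : (fun x => χ x • (Q (h x) - x)) =ᶠ[𝓝 x] fun x => Q (h x) - x := by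
        filter_upwards [isOpen_ball.mem_nhds (show x ∈ ball 0 1 by simpa using h1)] with y hy
        have : χ y = 1 := χ.one_of_mem_closedBall (ball_subset_closedBall hy)
        simp [this]
      have hQd := (hQ.differentiable (by norm_num)) (h x)
      have hhd := (hh.differentiable (by norm_num)) x
      have hd : HasFDerivAt (fun x => Q (h x) - x)
          ((fderiv ℝ Q (h x)).comp (fderiv ℝ h x) - ContinuousLinearMap.id ℝ _) x :=
        (hQd.hasFDerivAt.comp x hhd.hasFDerivAt).sub (hasFDerivAt_id x)
      rw [hev.fderiv_eq, hd.fderiv, add_sub_cancel, ContinuousLinearMap.det,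
        LinearMap.det_eq_zero_iff_ker_ne_bot]
      have hk : LinearMap.ker (fderiv ℝ h x : EuclideanSpace ℝ (Fin (W + 1)) →ₗ[ℝ]
          EuclideanSpace ℝ (Fin W)) ≠ ⊥ := by
        apply LinearMap.ker_ne_bot_of_finrank_lt
        simp
      intro hbot
      apply hk
      rw [eq_bot_iff, ← hbot]
      intro v hv
      simp only [LinearMap.mem_ker] at hv ⊢
      have hv' : fderiv ℝ h x v = 0 := hv
      simp [hv']
    · right
      push Not at h1
      have hb := H x h1 hx.le
      have hx0 : 0 < ‖x‖ := by linarith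
      set e := (‖x‖)⁻¹ • x with he
      have hen : ‖e‖ = 1 := by
        rw [he, norm_smul, norm_inv, norm_norm, inv_mul_cancel₀ hx0.ne']
      have hxe : x = ‖x‖ • e := by rw [he, smul_smul, mul_inv_cancel₀ hx0.ne', one_smul]
      have hχ0 : 0 ≤ χ x := χ.nonneg
      have hχ1 : χ x ≤ 1 := χ.le_one
      have heq : x + χ x • (Q (h x) - x)
          = (χ x + (1 - χ x) * ‖x‖) • e + χ x • (Q (h x) - e) := by
        have hxe' : x - ‖x‖ • e = 0 := sub_eq_zero.2 hxe
        have : x + χ x • (Q (h x) - x) - ((χ x + (1 - χ x) * ‖x‖) • e + χ x • (Q (h x) - e))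
            = (1 - χ x) • (x - ‖x‖ • e) := by
          clear_value e
          module
        rw [hxe', smul_zero] at this
        exact sub_eq_zero.1 this
      rw [heq]
      have h2 : ‖(χ x + (1 - χ x) * ‖x‖) • e‖ = χ x + (1 - χ x) * ‖x‖ := by
        rw [norm_smul, hen, mul_one, Real.norm_of_nonneg]
        have := mul_nonneg (sub_nonneg.2 hχ1) hx0.le
        linarith
      have h3 : ‖χ x • (Q (h x) - e)‖ ≤ 1 / 2 := by
        rw [norm_smul, Real.norm_of_nonneg hχ0]
        nlinarith [norm_nonneg (Q (h x) - e)]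
      have h4 := norm_sub_le_norm_add ((χ x + (1 - χ x) * ‖x‖) • e) (χ x • (Q (h x) - e))
      rw [h2] at h4
      nlinarith

/-- A version of uniform continuity near a compact set. -/
theorem aux_unif {X Y : Type*} [PseudoMetricSpace X] [PseudoMetricSpace Y] (S : Set X)
    (hS : IsCompact S) (f : X → Y) (hf : Continuous f) (ε : ℝ) (hε : 0 < ε) :
    ∃ δ > 0, ∀ x ∈ S, ∀ z, dist x z < δ → dist (f x) (f z) < ε := by
  have := hS.uniformContinuousAt_of_continuousAt f (fun a _ => hf.continuousAt)
    (dist_mem_uniformity hε)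
  obtain ⟨δ, hδ, h⟩ := Metric.mem_uniformity_dist.1 this
  exact ⟨δ, hδ, fun x hx z hz => h hz hx⟩

/-- The topological core: the inverse of an injective continuous map of the sphere cannot be
approximated by maps factoring through `ℝ^W`. -/
theorem aux_topological {W d : ℕ}
    (Φ : EuclideanSpace ℝ (Fin W) → EuclideanSpace ℝ (Fin d)) (hΦ : ContDiff ℝ 1 Φ)
    (g : EuclideanSpace ℝ (Fin (W + 1)) → EuclideanSpace ℝ (Fin d))
    (hg : ContinuousOn g (sphere (0 : EuclideanSpace ℝ (Fin (W + 1))) 1))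
    (hinj : Set.InjOn g (sphere (0 : EuclideanSpace ℝ (Fin (W + 1))) 1)) :
    ∃ δ > 0, ∀ w : EuclideanSpace ℝ (Fin (W + 1)) → EuclideanSpace ℝ (Fin W),
      ContinuousOn w (sphere (0 : EuclideanSpace ℝ (Fin (W + 1))) 1) →
      (∀ y ∈ sphere (0 : EuclideanSpace ℝ (Fin (W + 1))) 1, ‖g y - Φ (w y)‖ < δ) → False := by
  set S := sphere (0 : EuclideanSpace ℝ (Fin (W + 1))) 1 with hS
  have hSc : IsCompact S := isCompact_sphere _ _
  have : CompactSpace S := isCompact_iff_compactSpace.1 hSc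
  have hemb : IsClosedEmbedding (S.domRestrict g) :=
    (continuousOn_iff_continuous_domRestrict.1 hg).isClosedEmbedding (injOn_iff_injective.1 hinj)
  obtain ⟨k₀, hk₀⟩ := ContinuousMap.exists_extension' hemb
    (⟨Subtype.val, continuous_subtype_val⟩ : C(S, EuclideanSpace ℝ (Fin (W + 1))))
  have hk₀' : ∀ y ∈ S, k₀ (g y) = y := fun y hy => congrFun hk₀ ⟨y, hy⟩
  obtain ⟨k, hk, hka, -⟩ := k₀.continuous.exists_contDiff_approx 1 (ε := fun _ => 1 / 8)
    continuous_const (fun _ => by norm_num)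
  have hk1 : ContDiff ℝ 1 k := hk
  obtain ⟨δ, hδ, hkδ⟩ := aux_unif (g '' S) (hSc.image_of_continuousOn hg) k hk1.continuous (1 / 8)
    (by norm_num)
  refine ⟨δ, hδ, fun w hw hwδ => ?_⟩
  have hQ : ContDiff ℝ 1 (fun v => k (Φ v)) := hk1.comp hΦ
  have hQw : ∀ y ∈ S, dist (k (Φ (w y))) y < 1 / 4 := by
    intro y hy
    have h1 := hkδ (g y) (mem_image_of_mem _ hy) (Φ (w y)) (by rw [dist_eq_norm]; exact hwδ y hy)
    have h2 := hka (g y)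
    rw [hk₀' y hy] at h2
    have := dist_triangle_left (k (Φ (w y))) y (k (g y))
    linarith
  obtain ⟨η, hη, hQη⟩ := aux_unif (w '' S) (hSc.image_of_continuousOn hw) _ hQ.continuous (1 / 4)
    (by norm_num)
  let T : Set (EuclideanSpace ℝ (Fin (W + 1))) := {x | 1 ≤ ‖x‖}
  have hT : IsClosed T := isClosed_le continuous_const continuous_norm
  have hmaps : ∀ x ∈ T, (‖x‖)⁻¹ • x ∈ S := by
    intro x hx
    have hx : 1 ≤ ‖x‖ := hx
    have hx0 : 0 < ‖x‖ := by linarith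
    rw [hS, mem_sphere_zero_iff_norm, norm_smul, norm_inv, norm_norm, inv_mul_cancel₀ hx0.ne']
  have hcont : ContinuousOn (fun x => w ((‖x‖)⁻¹ • x)) T := by
    have hc : ContinuousOn (fun x : EuclideanSpace ℝ (Fin (W + 1)) => (‖x‖)⁻¹ • x) T := by
      refine ContinuousOn.smul (ContinuousOn.inv₀ continuous_norm.continuousOn ?_) continuousOn_id
      intro x hx
      have hx : 1 ≤ ‖x‖ := hx
      linarith
    exact hw.comp hc hmaps
  obtain ⟨h₀, hh₀⟩ := ContinuousMap.exists_restrict_eq hT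
    (⟨T.domRestrict (fun x => w ((‖x‖)⁻¹ • x)), continuousOn_iff_continuous_domRestrict.1 hcont⟩ :
      C(T, EuclideanSpace ℝ (Fin W)))
  have hh₀' : ∀ x ∈ T, h₀ x = w ((‖x‖)⁻¹ • x) := fun x hx =>
    congrArg (fun f : C(T, EuclideanSpace ℝ (Fin W)) => f ⟨x, hx⟩) hh₀
  obtain ⟨h, hh, hha, -⟩ := h₀.continuous.exists_contDiff_approx 1 (ε := fun _ => η)
    continuous_const (fun _ => hη)
  refine aux_no_factor h (fun v => k (Φ v)) hh hQ fun x hx _ => ?_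
  have h1 := hha x
  rw [hh₀' x hx, dist_comm] at h1
  have h2 := hQη _ (mem_image_of_mem _ (hmaps x hx)) _ h1
  have h3 := hQw _ (hmaps x hx)
  rw [← dist_eq_norm]
  have := dist_triangle_left (k (Φ (h x))) ((‖x‖)⁻¹ • x) (k (Φ (w ((‖x‖)⁻¹ • x))))
  linarith

section flow
variable {W d : ℕ} {Φ : EuclideanSpace ℝ (Fin W) → EuclideanSpace ℝ (Fin d)}

theorem aux_grad (hΦ : ContDiff ℝ 1 Φ) (f : EuclideanSpace ℝ (Fin d))
    (w : EuclideanSpace ℝ (Fin W)) :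
    HasGradientAt (loss Φ f) (-(ContinuousLinearMap.adjoint (fderiv ℝ Φ w) (f - Φ w))) w := by
  have hd := ((hΦ.differentiable (by norm_num)) w).hasFDerivAt
  have h1 := ((hd.const_sub f).norm_sq).const_mul (1 / 2 : ℝ)
  rw [hasGradientAt_iff_hasFDerivAt]
  refine h1.congr_fderiv ?_
  ext v
  simp [ContinuousLinearMap.adjoint_inner_left]

/-- The trajectory predicate, with the gradient made explicit. -/
theorem aux_deriv (hΦ : ContDiff ℝ 1 Φ) {f : EuclideanSpace ℝ (Fin d)}
    {w : ℝ → EuclideanSpace ℝ (Fin W)} {t : ℝ}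
    (h : HasDerivAt w (-(gradient (loss Φ f) (w t))) t) :
    HasDerivAt w (ContinuousLinearMap.adjoint (fderiv ℝ Φ (w t)) (f - Φ (w t))) t := by
  rwa [(aux_grad hΦ f (w t)).gradient, neg_neg] at h

theorem aux_antitone (hΦ : ContDiff ℝ 1 Φ) {f : EuclideanSpace ℝ (Fin d)}
    {w : ℝ → EuclideanSpace ℝ (Fin W)}
    (h : ∀ t ≥ (0 : ℝ), HasDerivAt w (-(gradient (loss Φ f) (w t))) t) :
    AntitoneOn (fun t => loss Φ f (w t)) (Ici 0) := by
  have hd : ∀ t ≥ (0 : ℝ), HasDerivAt (fun t => loss Φ f (w t))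
      (-‖gradient (loss Φ f) (w t)‖ ^ 2) t := by
    intro t ht
    have h1 := (aux_grad hΦ f (w t))
    rw [← h1.gradient] at h1
    have h2 := (hasGradientAt_iff_hasFDerivAt.1 h1).comp_hasDerivAt t (h t ht)
    refine h2.congr_deriv ?_
    rw [InnerProductSpace.toDual_apply_apply, inner_neg_right, real_inner_self_eq_norm_sq]
  refine antitoneOn_of_deriv_nonpos (convex_Ici 0)
    (fun t ht => (hd t ht).continuousAt.continuousWithinAt) ?_ ?_
  · rw [interior_Ici]
    exact fun t ht => (hd t (le_of_lt ht)).differentiableAt.differentiableWithinAt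
  · rw [interior_Ici]
    intro t ht
    rw [(hd t (le_of_lt ht)).deriv]
    simp

theorem aux_res (hΦ : ContDiff ℝ 1 Φ) {f : EuclideanSpace ℝ (Fin d)}
    {w : ℝ → EuclideanSpace ℝ (Fin W)} (h0 : w 0 = 0)
    (h : ∀ t ≥ (0 : ℝ), HasDerivAt w (-(gradient (loss Φ f) (w t))) t) {t : ℝ} (ht : 0 ≤ t) :
    ‖f - Φ (w t)‖ ≤ ‖f - Φ 0‖ := by
  have := aux_antitone hΦ h (mem_Ici.2 le_rfl) (mem_Ici.2 ht) ht
  simp only [loss, h0] at this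
  exact le_of_sq_le_sq (by linarith) (norm_nonneg _)

theorem aux_bound (hΦ : ContDiff ℝ 1 Φ) {K : NNReal} (hlip : LipschitzWith K (fderiv ℝ Φ))
    {f : EuclideanSpace ℝ (Fin d)} {w : ℝ → EuclideanSpace ℝ (Fin W)} (h0 : w 0 = 0)
    (h : ∀ t ≥ (0 : ℝ), HasDerivAt w (-(gradient (loss Φ f) (w t))) t) {A : ℝ}
    (hA : ‖f - Φ 0‖ ≤ A) {t T : ℝ} (ht : 0 ≤ t) (htT : t ≤ T) :
    ‖w t‖ ≤ gronwallBound 0 (K * A) (‖fderiv ℝ Φ 0‖ * A) T := by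
  have hA0 : 0 ≤ A := (norm_nonneg _).trans hA
  have hd := fun t (ht : t ≥ (0 : ℝ)) => aux_deriv hΦ (h t ht)
  have := norm_le_gronwallBound_of_norm_deriv_right_le (a := 0) (b := T) (δ := 0) (K := K * A)
    (ε := ‖fderiv ℝ Φ 0‖ * A)
    (fun t ht => (hd t ht.1).continuousAt.continuousWithinAt)
    (fun t ht => (hd t ht.1).hasDerivWithinAt) (by simp [h0]) (fun t ht => ?_) t ⟨ht, htT⟩
  · refine this.trans ?_
    rw [sub_zero]
    exact gronwallBound_mono le_rfl (by positivity) (by positivity) htT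
  · have h1 := (aux_res hΦ h0 h ht.1).trans hA
    have h2 : ‖fderiv ℝ Φ (w t)‖ ≤ ‖fderiv ℝ Φ 0‖ + K * ‖w t‖ := by
      have h3 := hlip.norm_sub_le (w t) 0
      have h4 := norm_sub_norm_le (fderiv ℝ Φ (w t)) (fderiv ℝ Φ 0)
      rw [sub_zero] at h3
      linarith
    calc _ ≤ ‖ContinuousLinearMap.adjoint (fderiv ℝ Φ (w t))‖ * ‖f - Φ (w t)‖ :=
          ContinuousLinearMap.le_opNorm _ _
      _ = ‖fderiv ℝ Φ (w t)‖ * ‖f - Φ (w t)‖ := by rw [LinearIsometryEquiv.norm_map]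
      _ ≤ (‖fderiv ℝ Φ 0‖ + K * ‖w t‖) * A := by gcongr
      _ = _ := by ring

theorem aux_dep (hΦ : ContDiff ℝ 1 Φ) {K : NNReal} (hlip : LipschitzWith K (fderiv ℝ Φ))
    (A T : ℝ) (hT : 0 ≤ T) : ∃ L B : ℝ, ∀ (f₁ f₂ : EuclideanSpace ℝ (Fin d))
    (w₁ w₂ : ℝ → EuclideanSpace ℝ (Fin W)), ‖f₁ - Φ 0‖ ≤ A → ‖f₂ - Φ 0‖ ≤ A →
    w₁ 0 = 0 → w₂ 0 = 0 →
    (∀ t ≥ (0 : ℝ), HasDerivAt w₁ (-(gradient (loss Φ f₁) (w₁ t))) t) →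
    (∀ t ≥ (0 : ℝ), HasDerivAt w₂ (-(gradient (loss Φ f₂) (w₂ t))) t) →
    ‖w₁ T - w₂ T‖ ≤ gronwallBound 0 L (B * ‖f₁ - f₂‖) T := by
  set M := gronwallBound 0 (K * A) (‖fderiv ℝ Φ 0‖ * A) T with hM
  set B := ‖fderiv ℝ Φ 0‖ + K * M with hB
  refine ⟨K * A + B * B, B, fun f₁ f₂ w₁ w₂ hf₁ hf₂ h01 h02 h1 h2 => ?_⟩
  have hA0 : 0 ≤ A := (norm_nonneg _).trans hf₁
  have hd1 := fun t (ht : t ≥ (0 : ℝ)) => aux_deriv hΦ (h1 t ht)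
  have hd2 := fun t (ht : t ≥ (0 : ℝ)) => aux_deriv hΦ (h2 t ht)
  have hDB : ∀ v, ‖v‖ ≤ M → ‖fderiv ℝ Φ v‖ ≤ B := by
    intro v hv
    have h3 := hlip.norm_sub_le v 0
    have h4 := norm_sub_norm_le (fderiv ℝ Φ v) (fderiv ℝ Φ 0)
    rw [sub_zero] at h3
    have : (K : ℝ) * ‖v‖ ≤ K * M := by gcongr
    linarith
  have := norm_le_gronwallBound_of_norm_deriv_right_le (a := 0) (b := T) (δ := 0)
    (K := K * A + B * B) (ε := B * ‖f₁ - f₂‖) (f := fun t => w₁ t - w₂ t)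
    (fun t ht => ((hd1 t ht.1).sub (hd2 t ht.1)).continuousAt.continuousWithinAt)
    (fun t ht => ((hd1 t ht.1).sub (hd2 t ht.1)).hasDerivWithinAt) (by simp [h01, h02])
    (fun t ht => ?_) T ⟨hT, le_rfl⟩
  · simpa using this
  have b1 : ‖w₁ t‖ ≤ M := aux_bound hΦ hlip h01 h1 hf₁ ht.1 ht.2.le
  have b2 : ‖w₂ t‖ ≤ M := aux_bound hΦ hlip h02 h2 hf₂ ht.1 ht.2.le
  have r1 : ‖f₁ - Φ (w₁ t)‖ ≤ A := (aux_res hΦ h01 h1 ht.1).trans hf₁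
  have hB0 : 0 ≤ B := (norm_nonneg _).trans (hDB _ b2)
  have hmv : ‖Φ (w₁ t) - Φ (w₂ t)‖ ≤ B * ‖w₁ t - w₂ t‖ :=
    (convex_closedBall (0 : EuclideanSpace ℝ (Fin W)) M).norm_image_sub_le_of_norm_fderiv_le
      (𝕜 := ℝ) (fun x _ => (hΦ.differentiable (by norm_num)) x)
      (fun x hx => hDB x (by simpa using hx)) (by simpa using b2) (by simpa using b1)
  have heq : ContinuousLinearMap.adjoint (fderiv ℝ Φ (w₁ t)) (f₁ - Φ (w₁ t))
      - ContinuousLinearMap.adjoint (fderiv ℝ Φ (w₂ t)) (f₂ - Φ (w₂ t))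
      = ContinuousLinearMap.adjoint (fderiv ℝ Φ (w₁ t) - fderiv ℝ Φ (w₂ t)) (f₁ - Φ (w₁ t))
      + ContinuousLinearMap.adjoint (fderiv ℝ Φ (w₂ t))
        ((f₁ - f₂) - (Φ (w₁ t) - Φ (w₂ t))) := by
    simp only [map_sub, sub_apply]
    abel
  rw [heq]
  have e1 : ‖ContinuousLinearMap.adjoint (fderiv ℝ Φ (w₁ t) - fderiv ℝ Φ (w₂ t)) (f₁ - Φ (w₁ t))‖
      ≤ (K * ‖w₁ t - w₂ t‖) * A := by
    refine (ContinuousLinearMap.le_opNorm _ _).trans ?_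
    rw [LinearIsometryEquiv.norm_map]
    exact mul_le_mul (hlip.norm_sub_le _ _) r1 (norm_nonneg _) (by positivity)
  have e2 : ‖ContinuousLinearMap.adjoint (fderiv ℝ Φ (w₂ t)) ((f₁ - f₂) - (Φ (w₁ t) - Φ (w₂ t)))‖
      ≤ B * (‖f₁ - f₂‖ + B * ‖w₁ t - w₂ t‖) := by
    refine (ContinuousLinearMap.le_opNorm _ _).trans ?_
    rw [LinearIsometryEquiv.norm_map]
    refine mul_le_mul (hDB _ b2) ((norm_sub_le _ _).trans ?_) (norm_nonneg _) hB0
    linarith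
  refine (norm_add_le _ _).trans ((add_le_add e1 e2).trans (le_of_eq ?_))
  ring

end flow

/-- The image of any continuous injection of the `W`-sphere into the target space contains
a non-learnable target. -/
theorem sphere_image_contains_nonlearnable (W d : ℕ)
    (Φ : EuclideanSpace ℝ (Fin W) → EuclideanSpace ℝ (Fin d))
    (hΦ : ContDiff ℝ 1 Φ) (K : NNReal) (hlip : LipschitzWith K (fderiv ℝ Φ))
    (g : EuclideanSpace ℝ (Fin (W + 1)) → EuclideanSpace ℝ (Fin d))
    (hg : ContinuousOn g (sphere (0 : EuclideanSpace ℝ (Fin (W + 1))) 1))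
    (hinj : Set.InjOn g (sphere (0 : EuclideanSpace ℝ (Fin (W + 1))) 1)) :
    ¬ (g '' sphere (0 : EuclideanSpace ℝ (Fin (W + 1))) 1 ⊆ learnableSet Φ) := by
  intro hsub
  obtain ⟨δ, hδ, htop⟩ := aux_topological Φ hΦ g hg hinj
  have hSc : IsCompact (sphere (0 : EuclideanSpace ℝ (Fin (W + 1))) 1) := isCompact_sphere _ _
  have hex : ∀ y, ∃ w : ℝ → EuclideanSpace ℝ (Fin W),
      y ∈ sphere (0 : EuclideanSpace ℝ (Fin (W + 1))) 1 → w 0 = 0 ∧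
      (∀ t ≥ (0 : ℝ), HasDerivAt w (-(gradient (loss Φ (g y)) (w t))) t) ∧
      (⨅ t : Set.Ici (0 : ℝ), loss Φ (g y) (w t)) = 0 := by
    intro y
    by_cases hy : y ∈ sphere (0 : EuclideanSpace ℝ (Fin (W + 1))) 1
    · obtain ⟨w, hw⟩ := hsub (mem_image_of_mem g hy)
      exact ⟨w, fun _ => hw⟩
    · exact ⟨0, fun h => absurd h hy⟩
  choose w hw using hex
  obtain ⟨A, hA⟩ := hSc.exists_bound_of_continuousOn (f := fun y => g y - Φ 0)
    (hg.sub continuousOn_const)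
  have hcont : ∀ T ≥ (0 : ℝ), ContinuousOn (fun y => w y T)
      (sphere (0 : EuclideanSpace ℝ (Fin (W + 1))) 1) := by
    intro T hT y hy
    obtain ⟨L, B, hLB⟩ := aux_dep hΦ hlip A T hT
    rw [ContinuousWithinAt, tendsto_iff_norm_sub_tendsto_zero]
    have hlim : Tendsto (fun z => gronwallBound 0 L (B * ‖g z - g y‖) T)
        (𝓝[sphere (0 : EuclideanSpace ℝ (Fin (W + 1))) 1] y) (𝓝 0) := by
      have h1 := tendsto_iff_norm_sub_tendsto_zero.1 (hg y hy)
      have h2 := ((gronwallBound_continuous_ε 0 L T).tendsto (B * 0)).comp (h1.const_mul B)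
      rwa [mul_zero, gronwallBound_ε0_δ0] at h2
    refine squeeze_zero' (Eventually.of_forall fun _ => norm_nonneg _) ?_ hlim
    filter_upwards [self_mem_nhdsWithin] with z hz
    exact hLB _ _ _ _ (hA z hz) (hA y hy) (hw z hz).1 (hw y hy).1 (hw z hz).2.1 (hw y hy).2.1
  have hunif : ∃ T ≥ (0 : ℝ), ∀ y ∈ sphere (0 : EuclideanSpace ℝ (Fin (W + 1))) 1,
      ∀ t ≥ T, loss Φ (g y) (w y t) < δ ^ 2 / 2 := by
    refine hSc.induction_on (p := fun s => ∃ T ≥ (0 : ℝ), ∀ y ∈ s,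
      ∀ t ≥ T, loss Φ (g y) (w y t) < δ ^ 2 / 2) ⟨0, le_rfl, by simp⟩ ?_ ?_ ?_
    · rintro s t hst ⟨T, hT, h⟩
      exact ⟨T, hT, fun y hy => h y (hst hy)⟩
    · rintro s t ⟨T, hT, h⟩ ⟨T', hT', h'⟩
      refine ⟨max T T', le_max_of_le_left hT, fun y hy r hr => ?_⟩
      rcases hy with hy | hy
      · exact h y hy r ((le_max_left _ _).trans hr)
      · exact h' y hy r ((le_max_right _ _).trans hr)
    · intro y hy
      have hlt : (⨅ t : Set.Ici (0 : ℝ), loss Φ (g y) (w y t)) < δ ^ 2 / 2 := by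
        rw [(hw y hy).2.2]; positivity
      obtain ⟨⟨T, hT⟩, hTlt⟩ := exists_lt_of_ciInf_lt hlt
      have hT : 0 ≤ T := hT
      have hc : ContinuousOn (fun z => loss Φ (g z) (w z T))
          (sphere (0 : EuclideanSpace ℝ (Fin (W + 1))) 1) := by
        unfold loss
        exact continuousOn_const.mul ((hg.sub (hΦ.continuous.comp_continuousOn (hcont T hT))).norm.pow 2)
      have hev := (hc y hy).eventually_lt_const hTlt
      refine ⟨_, inter_mem hev self_mem_nhdsWithin, T, hT, ?_⟩
      rintro z ⟨hz1, hz2⟩ t ht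
      have hz1 : loss Φ (g z) (w z T) < δ ^ 2 / 2 := hz1
      exact lt_of_le_of_lt (aux_antitone hΦ (hw z hz2).2.1 (mem_Ici.2 hT)
        (mem_Ici.2 (hT.trans ht)) ht) hz1
  obtain ⟨T, hT, hlt⟩ := hunif
  refine htop (fun y => w y T) (hcont T hT) fun y hy => ?_
  have := hlt y hy T le_rfl
  unfold loss at this
  exact lt_of_pow_lt_pow_left₀ 2 hδ.le (by linarith)
end

section
/- If 1 ≤ W < d and Φ : ℝ^W → ℝ^d is C¹ with Lipschitz differential, then the set of non-learnable targets ℝ^d \ F_Φ is dense in ℝ^d. -/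
open MeasureTheory Filter Topology Set

/-- Integrals over a compact set of a polynomial family of continuous functions are polynomial. -/
lemma poly_integral {E : Type*} [TopologicalSpace E] [T2Space E] [MeasurableSpace E] [BorelSpace E]
    (μ : Measure E) [IsFiniteMeasureOnCompacts μ] (B : Set E) (hB : IsCompact B)
    (P : Polynomial C(E, ℝ)) :
    ∃ Q : Polynomial ℝ, ∀ t : ℝ,
      Q.eval t = ∫ x in B, Polynomial.eval₂RingHom
        ((ContinuousMap.evalAlgHom ℝ ℝ x : C(E, ℝ) →ₐ[ℝ] ℝ) : C(E, ℝ) →+* ℝ) t P ∂μ := by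
  refine ⟨∑ i ∈ Finset.range (P.natDegree + 1),
    Polynomial.C (∫ x in B, P.coeff i x ∂μ) * Polynomial.X ^ i, fun t => ?_⟩
  simp only [Polynomial.coe_eval₂RingHom, Polynomial.eval₂_eq_sum_range]
  rw [integral_finsetSum]
  · rw [Polynomial.eval_finsetSum]
    refine Finset.sum_congr rfl fun i _ => ?_
    rw [integral_mul_const]
    simp
  · intro i _
    refine Integrable.mul_const ?_ _
    exact (P.coeff i).continuous.continuousOn.integrableOn_compact hB

lemma poly_family {d : ℕ} (u : EuclideanSpace ℝ (Fin d) → EuclideanSpace ℝ (Fin d))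
    (hu : ContDiff ℝ 1 u) (q : MvPolynomial (Fin d) ℝ) :
    ∃ P : Polynomial C(EuclideanSpace ℝ (Fin d), ℝ), ∀ (t : ℝ) (x : EuclideanSpace ℝ (Fin d)),
      Polynomial.eval₂RingHom
        ((ContinuousMap.evalAlgHom ℝ ℝ x : C(EuclideanSpace ℝ (Fin d), ℝ) →ₐ[ℝ] ℝ) :
          C(EuclideanSpace ℝ (Fin d), ℝ) →+* ℝ) t P
      = (ContinuousLinearMap.id ℝ (EuclideanSpace ℝ (Fin d)) + t • fderiv ℝ u x).det
        * MvPolynomial.eval (fun i => (x + t • u x) i) q := by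
  have hfd : Continuous (fderiv ℝ u) := hu.continuous_fderiv (by norm_num)
  let m : Fin d → Fin d → C(EuclideanSpace ℝ (Fin d), ℝ) := fun i j =>
    ⟨fun x => (fderiv ℝ u x (EuclideanSpace.basisFun (Fin d) ℝ j)) i, by fun_prop⟩
  let M : Matrix (Fin d) (Fin d) (Polynomial C(EuclideanSpace ℝ (Fin d), ℝ)) :=
    Matrix.of fun i j => (if i = j then 1 else 0) + Polynomial.X * Polynomial.C (m i j)
  have huc : Continuous u := hu.continuous
  let a : Fin d → Polynomial C(EuclideanSpace ℝ (Fin d), ℝ) := fun i =>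
    Polynomial.C ⟨fun x => x i, by fun_prop⟩ + Polynomial.X * Polynomial.C ⟨fun x => u x i, by fun_prop⟩
  let cc : ℝ →+* Polynomial C(EuclideanSpace ℝ (Fin d), ℝ) :=
    Polynomial.C.comp (algebraMap ℝ C(EuclideanSpace ℝ (Fin d), ℝ))
  refine ⟨M.det * MvPolynomial.eval₂ cc a q, fun t x => ?_⟩
  rw [map_mul]
  congr 1
  · rw [RingHom.map_det]
    rw [ContinuousLinearMap.det, ← LinearMap.det_toMatrix (EuclideanSpace.basisFun (Fin d) ℝ).toBasis]
    congr 1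
    ext i j
    simp [M, m, LinearMap.toMatrix_apply]
    split_ifs with h1 <;> simp [h1, mul_comm]
  · rw [MvPolynomial.hom_eval₂]
    have h1 : (Polynomial.eval₂RingHom
        ((ContinuousMap.evalAlgHom ℝ ℝ x : C(EuclideanSpace ℝ (Fin d), ℝ) →ₐ[ℝ] ℝ) :
          C(EuclideanSpace ℝ (Fin d), ℝ) →+* ℝ) t).comp cc = RingHom.id ℝ := by
      refine RingHom.ext fun r => ?_
      simp [cc]
    rw [h1, MvPolynomial.eval₂_id]
    congr 1
    congr 1
    funext i
    simp [a]
    ring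

lemma small_t {d : ℕ} (u : EuclideanSpace ℝ (Fin d) → EuclideanSpace ℝ (Fin d))
    (hu : ContDiff ℝ 1 u) (B : Set (EuclideanSpace ℝ (Fin d))) (hB : IsCompact B)
    (huB : ∀ x, x ∉ B → u x = 0) :
    ∃ τ > 0, ∀ t ∈ Set.Ioo (0 : ℝ) τ, ∀ φ : EuclideanSpace ℝ (Fin d) → ℝ,
      ∫ x in B, (ContinuousLinearMap.id ℝ (EuclideanSpace ℝ (Fin d)) + t • fderiv ℝ u x).det
        * φ (x + t • u x) = ∫ x in B, φ x := by
  have hcs : HasCompactSupport u := HasCompactSupport.intro hB huB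
  obtain ⟨C, hC⟩ := hu.lipschitzWith_of_hasCompactSupport hcs (by norm_num)
  have hCn : ∀ x, ‖fderiv ℝ u x‖ ≤ C := fun x => norm_fderiv_le_of_lipschitz ℝ hC
  have hdet : ∀ᶠ A in 𝓝 (ContinuousLinearMap.id ℝ (EuclideanSpace ℝ (Fin d))),
      0 < ContinuousLinearMap.det A := by
    refine ContinuousLinearMap.continuous_det.continuousAt.eventually_const_lt ?_
    simp [ContinuousLinearMap.det]
  obtain ⟨η, hη, hη'⟩ := Metric.eventually_nhds_iff.1 hdet
  have hC1 : (0 : ℝ) < C + 1 := by positivity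
  refine ⟨min η 1 / (C + 1), by positivity, fun t ht φ => ?_⟩
  have ht0 := ht.1
  have htC : t * (C + 1) < min η 1 := (lt_div_iff₀ hC1).1 ht.2
  have htC1 : t * C < 1 := by
    have := min_le_right η 1
    nlinarith
  have htCη : t * C < η := by
    have := min_le_left η 1
    nlinarith
  set H : EuclideanSpace ℝ (Fin d) → EuclideanSpace ℝ (Fin d) := fun x => x + t • u x with hH
  have hpos : ∀ x, 0 < (ContinuousLinearMap.id ℝ (EuclideanSpace ℝ (Fin d)) + t • fderiv ℝ u x).det := by
    intro x
    apply hη'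
    rw [dist_eq_norm, add_sub_cancel_left, norm_smul, Real.norm_of_nonneg ht0.le]
    exact lt_of_le_of_lt (mul_le_mul_of_nonneg_left (hCn x) ht0.le) htCη
  have hinj : Function.Injective H := by
    intro x y hxy
    have h1 : x - y = t • (u y - u x) := by
      simp only [hH] at hxy
      rw [smul_sub, sub_eq_sub_iff_add_eq_add, hxy, add_comm]
    have h2 : ‖x - y‖ ≤ (t * C) * ‖x - y‖ := by
      conv_lhs => rw [h1]
      rw [norm_smul, Real.norm_of_nonneg ht0.le, mul_assoc]
      refine mul_le_mul_of_nonneg_left ?_ ht0.le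
      have := hC.dist_le_mul y x
      rwa [dist_eq_norm, dist_eq_norm, norm_sub_rev y x] at this
    have h3 : ‖x - y‖ = 0 := by
      have := norm_nonneg (x - y)
      nlinarith
    exact sub_eq_zero.1 (norm_eq_zero.1 h3)
  have hsurj : Function.Surjective H := by
    intro y
    have hK : ContractingWith (t.toNNReal * C) (fun x => y - t • u x) := by
      refine ⟨?_, ?_⟩
      · rw [← NNReal.coe_lt_coe]
        simpa [ht0.le] using htC1
      · refine LipschitzWith.of_dist_le_mul fun a b => ?_
        rw [dist_sub_left, dist_smul₀, Real.norm_of_nonneg ht0.le]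
        simp only [NNReal.coe_mul, Real.coe_toNNReal _ ht0.le]
        rw [mul_assoc]
        exact mul_le_mul_of_nonneg_left (hC.dist_le_mul a b) ht0.le
    have := hK.fixedPoint_isFixedPt
    rw [Function.IsFixedPt] at this
    exact ⟨_, (sub_eq_iff_eq_add.1 this).symm⟩
  have hout : ∀ x, x ∉ B → H x = x := fun x hx => by simp [hH, huB x hx]
  have himg : H '' B = B := by
    ext y
    constructor
    · rintro ⟨x, hx, rfl⟩
      by_contra hy
      exact hy ((hinj (hout _ hy)).symm ▸ hx)
    · intro hy
      obtain ⟨x, rfl⟩ := hsurj y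
      refine ⟨x, ?_, rfl⟩
      by_contra hx
      rw [hout x hx] at hy
      exact hx hy
  have hder : ∀ x ∈ B, HasFDerivWithinAt H
      (ContinuousLinearMap.id ℝ (EuclideanSpace ℝ (Fin d)) + t • fderiv ℝ u x) B x := by
    intro x _
    have h1 : HasFDerivAt u (fderiv ℝ u x) x :=
      (hu.differentiable (by norm_num) x).hasFDerivAt
    exact ((hasFDerivAt_id x).add (h1.const_smul t)).hasFDerivWithinAt
  have key := integral_image_eq_integral_abs_det_fderiv_smul volume hB.measurableSet hder
    hinj.injOn φ
  rw [himg] at key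
  rw [key]
  simp only [abs_of_pos (hpos _), smul_eq_mul, hH]

lemma degree_poly {d : ℕ} (u : EuclideanSpace ℝ (Fin d) → EuclideanSpace ℝ (Fin d))
    (hu : ContDiff ℝ 1 u) (B : Set (EuclideanSpace ℝ (Fin d))) (hB : IsCompact B)
    (huB : ∀ x, x ∉ B → u x = 0) (q : MvPolynomial (Fin d) ℝ) :
    ∫ x in B, (ContinuousLinearMap.id ℝ (EuclideanSpace ℝ (Fin d)) + fderiv ℝ u x).det
        * MvPolynomial.eval (fun i => (x + u x) i) q
      = ∫ x in B, MvPolynomial.eval (fun i => x i) q := by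
  obtain ⟨τ, hτ, h⟩ := small_t u hu B hB huB
  obtain ⟨P, hP⟩ := poly_family u hu q
  obtain ⟨Q, hQ⟩ := poly_integral volume B hB P
  simp only [hP] at hQ
  have hQc : Q = Polynomial.C (∫ x in B, MvPolynomial.eval (fun i => x i) q) := by
    apply Polynomial.eq_of_infinite_eval_eq
    refine (Set.Ioo_infinite hτ).mono fun t ht => ?_
    simp only [Set.mem_ofPred_eq, Polynomial.eval_C]
    rw [hQ, h t ht (fun y => MvPolynomial.eval (fun i => y i) q)]
  have h1 := hQ 1
  rw [hQc, Polynomial.eval_C] at h1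
  rw [h1]
  simp

lemma poly_approx {d : ℕ} (B : Set (EuclideanSpace ℝ (Fin d))) (hB : IsCompact B)
    (φ : EuclideanSpace ℝ (Fin d) → ℝ) (hφ : ContinuousOn φ B) (ε : ℝ) (hε : 0 < ε) :
    ∃ q : MvPolynomial (Fin d) ℝ, ∀ x ∈ B, |MvPolynomial.eval (fun i => x i) q - φ x| < ε := by
  have : CompactSpace B := isCompact_iff_compactSpace.1 hB
  let c : Fin d → C(B, ℝ) := fun i => ⟨fun x => (x : EuclideanSpace ℝ (Fin d)) i, by fun_prop⟩
  let A : Subalgebra ℝ C(B, ℝ) := (MvPolynomial.aeval c : MvPolynomial (Fin d) ℝ →ₐ[ℝ] C(B, ℝ)).range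
  have hA : A.SeparatesPoints := by
    intro x y hxy
    have : ∃ i, (x : EuclideanSpace ℝ (Fin d)) i ≠ (y : EuclideanSpace ℝ (Fin d)) i := by
      by_contra! hcon
      exact hxy (Subtype.ext (by ext i; exact hcon i))
    obtain ⟨i, hi⟩ := this
    exact ⟨c i, ⟨c i, ⟨MvPolynomial.X i, by simp⟩, rfl⟩, hi⟩
  obtain ⟨⟨g, q, hq⟩, hg⟩ := ContinuousMap.exists_mem_subalgebra_near_continuous_of_separatesPoints A hA
    (fun x : B => φ x) hφ.domRestrict ε hε
  refine ⟨q, fun x hx => ?_⟩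
  have h1 := hg ⟨x, hx⟩
  have h2 : g ⟨x, hx⟩ = MvPolynomial.eval (fun i => x i) q := by
    rw [← hq]
    have := MvPolynomial.map_aeval (R := ℝ) c
      ((ContinuousMap.evalAlgHom ℝ ℝ (⟨x, hx⟩ : B) : C(B, ℝ) →ₐ[ℝ] ℝ) : C(B, ℝ) →+* ℝ) q
    refine this.trans ?_
    rfl
  simpa [h2] using h1

/-- A `C¹` compactly supported perturbation of the identity hits every point of the ball. -/
lemma perturb_surj {d : ℕ} (u : EuclideanSpace ℝ (Fin d) → EuclideanSpace ℝ (Fin d))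
    (hu : ContDiff ℝ 1 u) (p : EuclideanSpace ℝ (Fin d)) (r : ℝ) (hr : 0 < r)
    (huB : ∀ x, x ∉ Metric.closedBall p r → u x = 0) :
    ∃ x ∈ Metric.closedBall p r, x + u x = p := by
  by_contra! hcon
  set B := Metric.closedBall p r with hBdef
  have hB : IsCompact B := isCompact_closedBall p r
  have hc : Continuous fun x => x + u x := continuous_id.add hu.continuous
  have hHB : IsCompact ((fun x => x + u x) '' B) := hB.image hc
  have hp : p ∈ ((fun x => x + u x) '' B)ᶜ := by
    rintro ⟨x, hx, hxp⟩
    exact hcon x hx hxp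
  obtain ⟨δ, hδ, hδ'⟩ := Metric.isOpen_iff.1 hHB.isClosed.isOpen_compl p hp
  let φ : EuclideanSpace ℝ (Fin d) → ℝ := fun y => max 0 (δ - dist y p)
  have hφc : Continuous φ := by fun_prop
  have hφH : ∀ x ∈ B, φ (x + u x) = 0 := by
    intro x hx
    refine max_eq_left ?_
    by_contra! hlt
    have : x + u x ∈ Metric.ball p δ := by
      rw [Metric.mem_ball]; linarith
    exact hδ' this ⟨x, hx, rfl⟩
  have hφint : 0 < ∫ x in B, φ x := by
    rw [setIntegral_pos_iff_support_of_nonneg_ae]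
    · have hsub : Metric.ball p (min δ r) ⊆ Function.support φ ∩ B := by
        intro x hx
        rw [Metric.mem_ball, lt_min_iff] at hx
        refine ⟨?_, Metric.mem_closedBall.2 hx.2.le⟩
        have : 0 < φ x := lt_max_of_lt_right (by linarith)
        exact this.ne'
      exact lt_of_lt_of_le (Metric.measure_ball_pos volume p (lt_min hδ hr)) (measure_mono hsub)
    · exact Eventually.of_forall fun x => le_max_left _ _
    · exact hφc.continuousOn.integrableOn_compact hB
  set I := ∫ x in B, φ x with hI
  set D : EuclideanSpace ℝ (Fin d) → ℝ := fun x =>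
    (ContinuousLinearMap.id ℝ (EuclideanSpace ℝ (Fin d)) + fderiv ℝ u x).det with hD
  have hfd : Continuous (fderiv ℝ u) := hu.continuous_fderiv (by norm_num)
  have hDc : Continuous D := ContinuousLinearMap.continuous_det.comp (continuous_const.add hfd)
  set J := ∫ x in B, |D x| with hJ
  have hJ0 : 0 ≤ J := integral_nonneg fun x => abs_nonneg _
  set V := ∫ x in B, (1 : ℝ) with hV
  have hV0 : 0 ≤ V := integral_nonneg fun x => zero_le_one
  set ε := I / (2 * (J + V + 1)) with hε
  have hε0 : 0 < ε := by positivity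
  obtain ⟨q, hq⟩ := poly_approx (B ∪ ((fun x => x + u x) '' B)) (hB.union hHB) φ hφc.continuousOn ε hε0
  have hdeg := degree_poly u hu B hB huB q
  have hqc : Continuous fun x : EuclideanSpace ℝ (Fin d) => MvPolynomial.eval (fun i => x i) q :=
    (MvPolynomial.continuous_eval q).comp (by fun_prop)
  have h1 : ∫ x in B, D x * MvPolynomial.eval (fun i => (x + u x) i) q ≤ ε * J := by
    rw [hJ, ← integral_const_mul]
    refine setIntegral_mono_on ?_ ?_ hB.measurableSet ?_
    · exact (hDc.mul (hqc.comp hc)).continuousOn.integrableOn_compact hB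
    · exact (continuous_const.mul hDc.abs).continuousOn.integrableOn_compact hB
    · intro x hx
      have h2 := hq (x + u x) (Or.inr ⟨x, hx, rfl⟩)
      rw [hφH x hx, sub_zero] at h2
      calc _ ≤ |D x * MvPolynomial.eval (fun i => (x + u x) i) q| := le_abs_self _
        _ = |D x| * |MvPolynomial.eval (fun i => (x + u x) i) q| := abs_mul _ _
        _ ≤ |D x| * ε := mul_le_mul_of_nonneg_left h2.le (abs_nonneg _)
        _ = _ := mul_comm _ _
  have h2 : I - ε * V ≤ ∫ x in B, MvPolynomial.eval (fun i => x i) q := by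
    rw [hI, hV, ← integral_const_mul, ← integral_sub]
    · refine setIntegral_mono_on ?_ ?_ hB.measurableSet ?_
      · exact (hφc.sub continuous_const).continuousOn.integrableOn_compact hB
      · exact hqc.continuousOn.integrableOn_compact hB
      · intro x hx
        have h2 := abs_lt.1 (hq x (Or.inl hx))
        simp only [mul_one]
        linarith [h2.1]
    · exact hφc.continuousOn.integrableOn_compact hB
    · exact continuous_const.continuousOn.integrableOn_compact hB
  have h3 : ε * (2 * (J + V + 1)) = I := by rw [hε]; field_simp
  have h4 : I - ε * V ≤ ε * J := by
    refine h2.trans (le_of_eq_of_le hdeg.symm h1)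
  nlinarith

lemma grad_loss {W d : ℕ} (Φ : EuclideanSpace ℝ (Fin W) → EuclideanSpace ℝ (Fin d))
    (hΦ : ContDiff ℝ 1 Φ) (f : EuclideanSpace ℝ (Fin d)) (w : EuclideanSpace ℝ (Fin W)) :
    HasGradientAt (loss Φ f) (-(ContinuousLinearMap.adjoint (fderiv ℝ Φ w) (f - Φ w))) w := by
  have h1 : HasFDerivAt Φ (fderiv ℝ Φ w) w := (hΦ.differentiable (by norm_num) w).hasFDerivAt
  have h2 : HasFDerivAt (fun w => f - Φ w) (-(fderiv ℝ Φ w)) w := h1.const_sub f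
  have h3 := (h2.norm_sq).const_mul (1 / 2 : ℝ)
  rw [hasGradientAt_iff_hasFDerivAt]
  refine h3.congr_fderiv ?_
  ext v
  simp [ContinuousLinearMap.adjoint_inner_left]

/-- The velocity field. -/
noncomputable def vel {W d : ℕ} (Φ : EuclideanSpace ℝ (Fin W) → EuclideanSpace ℝ (Fin d))
    (f : EuclideanSpace ℝ (Fin d)) (w : EuclideanSpace ℝ (Fin W)) : EuclideanSpace ℝ (Fin W) :=
  ContinuousLinearMap.adjoint (fderiv ℝ Φ w) (f - Φ w)

/-- A gradient flow trajectory. -/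
def IsTraj {W d : ℕ} (Φ : EuclideanSpace ℝ (Fin W) → EuclideanSpace ℝ (Fin d))
    (f : EuclideanSpace ℝ (Fin d)) (w : ℝ → EuclideanSpace ℝ (Fin W)) : Prop :=
  w 0 = 0 ∧ ∀ t ≥ (0 : ℝ), HasDerivAt w (vel Φ f (w t)) t

lemma traj_loss {W d : ℕ} (Φ : EuclideanSpace ℝ (Fin W) → EuclideanSpace ℝ (Fin d))
    (hΦ : ContDiff ℝ 1 Φ) (f : EuclideanSpace ℝ (Fin d)) (w : ℝ → EuclideanSpace ℝ (Fin W))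
    (hw : IsTraj Φ f w) (t : ℝ) (ht : 0 ≤ t) :
    HasDerivAt (fun s => loss Φ f (w s)) (-‖vel Φ f (w t)‖ ^ 2) t := by
  have h1 := (grad_loss Φ hΦ f (w t)).hasFDerivAt
  have h2 := h1.comp_hasDerivAt t (hw.2 t ht)
  refine h2.congr_deriv ?_
  change inner ℝ (-(vel Φ f (w t))) (vel Φ f (w t)) = _
  rw [inner_neg_left, real_inner_self_eq_norm_sq]

lemma traj_antitone {W d : ℕ} (Φ : EuclideanSpace ℝ (Fin W) → EuclideanSpace ℝ (Fin d))
    (hΦ : ContDiff ℝ 1 Φ) (f : EuclideanSpace ℝ (Fin d)) (w : ℝ → EuclideanSpace ℝ (Fin W))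
    (hw : IsTraj Φ f w) : AntitoneOn (fun s => loss Φ f (w s)) (Set.Ici 0) := by
  apply antitoneOn_of_deriv_nonpos (convex_Ici 0)
  · exact fun t ht => (traj_loss Φ hΦ f w hw t ht).continuousAt.continuousWithinAt
  · intro t ht
    rw [interior_Ici] at ht
    exact (traj_loss Φ hΦ f w hw t (le_of_lt ht)).differentiableAt.differentiableWithinAt
  · intro t ht
    rw [interior_Ici] at ht
    rw [(traj_loss Φ hΦ f w hw t (le_of_lt ht)).deriv]
    have := sq_nonneg ‖vel Φ f (w t)‖
    linarith

lemma traj_bound {W d : ℕ} (Φ : EuclideanSpace ℝ (Fin W) → EuclideanSpace ℝ (Fin d))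
    (hΦ : ContDiff ℝ 1 Φ) (f : EuclideanSpace ℝ (Fin d)) (w : ℝ → EuclideanSpace ℝ (Fin W))
    (hw : IsTraj Φ f w) (T : ℝ) (t : ℝ) (ht : t ∈ Set.Icc 0 T) :
    ‖w t‖ ≤ (T + loss Φ f 0) / 2 := by
  have hB : ∀ s ≥ (0 : ℝ), HasDerivAt (fun s => (s + loss Φ f 0 - loss Φ f (w s)) / 2)
      ((1 - -‖vel Φ f (w s)‖ ^ 2) / 2) s := fun s hs =>
    (((hasDerivAt_id s).add_const _).sub (traj_loss Φ hΦ f w hw s hs)).div_const 2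
  have h1 := image_norm_le_of_norm_deriv_right_le_deriv_boundary' (f := w) (a := 0) (b := T)
    (f' := fun s => vel Φ f (w s))
    (fun s hs => (hw.2 s hs.1).continuousAt.continuousWithinAt)
    (fun s hs => (hw.2 s hs.1).hasDerivWithinAt)
    (B := fun s => (s + loss Φ f 0 - loss Φ f (w s)) / 2)
    (B' := fun s => (1 - -‖vel Φ f (w s)‖ ^ 2) / 2)
    (by simp [hw.1])
    (fun s hs => (hB s hs.1).continuousAt.continuousWithinAt)
    (fun s hs => (hB s hs.1).hasDerivWithinAt)
    (fun s hs => by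
      have := sq_nonneg (‖vel Φ f (w s)‖ - 1)
      nlinarith) ht
  refine h1.trans ?_
  have : 0 ≤ loss Φ f (w t) := by unfold loss; positivity
  have := ht.2
  linarith

lemma vel_bounds {W d : ℕ} (Φ : EuclideanSpace ℝ (Fin W) → EuclideanSpace ℝ (Fin d))
    (hΦ : ContDiff ℝ 1 Φ) (K : NNReal) (hlip : LipschitzWith K (fderiv ℝ Φ))
    (f : EuclideanSpace ℝ (Fin d)) (R : ℝ) :
    ∃ M : ℝ, 0 ≤ M ∧ ∃ L : NNReal, LipschitzOnWith L (vel Φ f) (Metric.closedBall 0 R) ∧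
      ∀ f', ∀ w ∈ Metric.closedBall (0 : EuclideanSpace ℝ (Fin W)) R,
        dist (vel Φ f' w) (vel Φ f w) ≤ M * dist f' f := by
  have hfd : Continuous (fderiv ℝ Φ) := hΦ.continuous_fderiv (by norm_num)
  have hcomp : IsCompact (Metric.closedBall (0 : EuclideanSpace ℝ (Fin W)) R) :=
    isCompact_closedBall 0 R
  obtain ⟨M, hM⟩ := hcomp.exists_bound_of_continuousOn hfd.continuousOn
  obtain ⟨N, hN⟩ := hcomp.exists_bound_of_continuousOn
    (continuous_const.sub hΦ.continuous : Continuous fun w => f - Φ w).continuousOn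
  have hM' : ∀ w ∈ Metric.closedBall (0 : EuclideanSpace ℝ (Fin W)) R,
    ‖fderiv ℝ Φ w‖ ≤ max M 0 := fun w hw => (hM w hw).trans (le_max_left _ _)
  have hN' : ∀ w ∈ Metric.closedBall (0 : EuclideanSpace ℝ (Fin W)) R,
    ‖f - Φ w‖ ≤ max N 0 := fun w hw => (hN w hw).trans (le_max_left _ _)
  have hM0 : 0 ≤ max M 0 := le_max_right _ _
  have hN0 : 0 ≤ max N 0 := le_max_right _ _
  generalize max M 0 = M' at *
  generalize max N 0 = N' at *
  refine ⟨M', hM0, (K * N' + M' * M').toNNReal, ?_, ?_⟩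
  · refine LipschitzOnWith.of_dist_le_mul fun a ha b hb => ?_
    rw [Real.coe_toNNReal _ (by positivity)]
    have hΦlip : ‖Φ b - Φ a‖ ≤ M' * ‖b - a‖ :=
      (convex_closedBall 0 R).norm_image_sub_le_of_norm_fderiv_le
        (fun x _ => hΦ.differentiable (by norm_num) x) hM' ha hb
    have hl := hlip.dist_le_mul a b
    rw [dist_eq_norm, dist_eq_norm] at *
    have e : vel Φ f a - vel Φ f b =
        ContinuousLinearMap.adjoint (fderiv ℝ Φ a - fderiv ℝ Φ b) (f - Φ a) +
        ContinuousLinearMap.adjoint (fderiv ℝ Φ b) (Φ b - Φ a) := by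
      simp only [vel, map_sub, sub_apply]
      abel
    rw [e]
    refine (norm_add_le _ _).trans ?_
    have i1 := (ContinuousLinearMap.adjoint (fderiv ℝ Φ a - fderiv ℝ Φ b)).le_opNorm (f - Φ a)
    have i2 := (ContinuousLinearMap.adjoint (fderiv ℝ Φ b)).le_opNorm (Φ b - Φ a)
    rw [LinearIsometryEquiv.norm_map] at i1 i2
    have i3 : ‖fderiv ℝ Φ a - fderiv ℝ Φ b‖ * ‖f - Φ a‖ ≤ (K * ‖a - b‖) * N' :=
      mul_le_mul hl (hN' a ha) (norm_nonneg _) (by positivity)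
    have i4 : ‖fderiv ℝ Φ b‖ * ‖Φ b - Φ a‖ ≤ M' * (M' * ‖b - a‖) :=
      mul_le_mul (hM' b hb) hΦlip (norm_nonneg _) hM0
    rw [norm_sub_rev b a] at i4
    linarith
  · intro f' w hw
    rw [dist_eq_norm, dist_eq_norm]
    have e : vel Φ f' w - vel Φ f w = ContinuousLinearMap.adjoint (fderiv ℝ Φ w) (f' - f) := by
      simp only [vel, map_sub]
      abel
    rw [e]
    have i1 := (ContinuousLinearMap.adjoint (fderiv ℝ Φ w)).le_opNorm (f' - f)
    rw [LinearIsometryEquiv.norm_map] at i1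
    exact i1.trans (mul_le_mul_of_nonneg_right (hM' w hw) (norm_nonneg _))

lemma traj_cont {W d : ℕ} (Φ : EuclideanSpace ℝ (Fin W) → EuclideanSpace ℝ (Fin d))
    (hΦ : ContDiff ℝ 1 Φ) (K : NNReal) (hlip : LipschitzWith K (fderiv ℝ Φ))
    (B : Set (EuclideanSpace ℝ (Fin d))) (hB : IsCompact B)
    (w : EuclideanSpace ℝ (Fin d) → ℝ → EuclideanSpace ℝ (Fin W))
    (hw : ∀ f ∈ B, IsTraj Φ f (w f)) (T : ℝ) (hT : 0 ≤ T) :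
    ContinuousOn (fun f => w f T) B := by
  have hlc : Continuous fun f => loss Φ f 0 := by unfold loss; fun_prop
  obtain ⟨C, hC⟩ := hB.exists_bound_of_continuousOn hlc.continuousOn
  have hR : ∀ f ∈ B, ∀ t ∈ Set.Icc 0 T, w f t ∈ Metric.closedBall 0 ((T + C) / 2) := by
    intro f hf t ht
    rw [mem_closedBall_zero_iff]
    have h1 := traj_bound Φ hΦ f (w f) (hw f hf) T t ht
    have h2 := (le_abs_self _).trans (hC f hf)
    linarith
  intro f hf
  obtain ⟨M, hM0, L, hL, hM⟩ := vel_bounds Φ hΦ K hlip f ((T + C) / 2)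
  have key : ∀ f' ∈ B, dist (w f' T) (w f T) ≤ gronwallBound 0 L (M * dist f' f + 0) (T - 0) := by
    intro f' hf'
    refine dist_le_of_approx_trajectories_ODE_of_mem (a := 0) (b := T)
      (v := fun _ => vel Φ f) (s := fun _ => Metric.closedBall 0 ((T + C) / 2))
      (f' := fun t => vel Φ f' (w f' t)) (g' := fun t => vel Φ f (w f t))
      (fun _ _ => hL) ?_ ?_ ?_ ?_ ?_ ?_ ?_ ?_ ?_ T ⟨hT, le_rfl⟩
    · exact fun s hs => ((hw f' hf').2 s hs.1).continuousAt.continuousWithinAt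
    · exact fun s hs => ((hw f' hf').2 s hs.1).hasDerivWithinAt
    · exact fun s hs => hM f' _ (hR f' hf' s ⟨hs.1, hs.2.le⟩)
    · exact fun s hs => hR f' hf' s ⟨hs.1, hs.2.le⟩
    · exact fun s hs => ((hw f hf).2 s hs.1).continuousAt.continuousWithinAt
    · exact fun s hs => ((hw f hf).2 s hs.1).hasDerivWithinAt
    · exact fun s hs => by simp
    · exact fun s hs => hR f hf s ⟨hs.1, hs.2.le⟩
    · simp [(hw f hf).1, (hw f' hf').1]
  have hlim : Tendsto (fun f' => gronwallBound 0 L (M * dist f' f + 0) (T - 0)) (𝓝[B] f) (𝓝 0) := by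
    have hc : Continuous fun f' => gronwallBound 0 L (M * dist f' f + 0) (T - 0) :=
      (gronwallBound_continuous_ε 0 L (T - 0)).comp (by fun_prop)
    have := (hc.tendsto f).mono_left (nhdsWithin_le_nhds (s := B))
    simpa [gronwallBound_ε0] using this
  rw [ContinuousWithinAt, tendsto_iff_dist_tendsto_zero]
  refine squeeze_zero' (Eventually.of_forall fun _ => dist_nonneg) ?_ hlim
  filter_upwards [self_mem_nhdsWithin] with f' hf'
  exact key f' hf'

lemma uniform_T {W d : ℕ} (Φ : EuclideanSpace ℝ (Fin W) → EuclideanSpace ℝ (Fin d))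
    (hΦ : ContDiff ℝ 1 Φ) (K : NNReal) (hlip : LipschitzWith K (fderiv ℝ Φ))
    (B : Set (EuclideanSpace ℝ (Fin d))) (hB : IsCompact B)
    (hBl : B ⊆ learnableSet Φ) (ε : ℝ) (hε : 0 < ε) :
    ∃ g : EuclideanSpace ℝ (Fin d) → EuclideanSpace ℝ (Fin W), ContinuousOn g B ∧
      ∀ f ∈ B, ‖Φ (g f) - f‖ < ε := by
  have hex : ∀ f, ∃ w : ℝ → EuclideanSpace ℝ (Fin W), f ∈ B → IsTraj Φ f w ∧
      (⨅ t : Set.Ici (0 : ℝ), loss Φ f (w t)) = 0 := by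
    intro f
    by_cases hf : f ∈ B
    · obtain ⟨w, h0, h1, h2⟩ := hBl hf
      refine ⟨w, fun _ => ⟨⟨h0, fun t ht => ?_⟩, h2⟩⟩
      have := h1 t ht
      rw [(grad_loss Φ hΦ f (w t)).gradient, neg_neg] at this
      exact this
    · exact ⟨0, fun h => absurd h hf⟩
  choose w hw using hex
  have hc : ∀ t, 0 ≤ t → ContinuousOn (fun f => w f t) B := fun t ht =>
    traj_cont Φ hΦ K hlip B hB w (fun f hf => (hw f hf).1) t ht
  have hΦc := hΦ.continuous
  have main : ∃ T : ℝ, 0 ≤ T ∧ ∀ f ∈ B, loss Φ f (w f T) < ε ^ 2 / 2 := by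
    have hind := hB.induction_on (p := fun S => ∃ T : ℝ, 0 ≤ T ∧ ∀ f ∈ S ∩ B,
      loss Φ f (w f T) < ε ^ 2 / 2) ?_ ?_ ?_ ?_
    · obtain ⟨T, hT, h⟩ := hind
      exact ⟨T, hT, fun f hf => h f ⟨hf, hf⟩⟩
    · exact ⟨0, le_rfl, fun f hf => absurd hf.1 (Set.notMem_empty f)⟩
    · rintro s t hst ⟨T, hT, h⟩
      exact ⟨T, hT, fun f hf => h f ⟨hst hf.1, hf.2⟩⟩
    · rintro s t ⟨T, hT, h⟩ ⟨T', hT', h'⟩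
      refine ⟨max T T', le_max_of_le_left hT, fun f hf => ?_⟩
      have ha := traj_antitone Φ hΦ f (w f) (hw f hf.2).1
      have hm : (0 : ℝ) ≤ max T T' := le_max_of_le_left hT
      rcases hf.1 with h1 | h1
      · exact lt_of_le_of_lt (ha hT hm (le_max_left _ _)) (h f ⟨h1, hf.2⟩)
      · exact lt_of_le_of_lt (ha hT' hm (le_max_right _ _)) (h' f ⟨h1, hf.2⟩)
    · intro f hf
      have h0 : (⨅ t : Set.Ici (0 : ℝ), loss Φ f (w f t)) < ε ^ 2 / 2 := by
        rw [(hw f hf).2]; positivity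
      obtain ⟨⟨t, ht⟩, hlt⟩ := exists_lt_of_ciInf_lt h0
      have hcl : ContinuousOn (fun f => loss Φ f (w f t)) B := by
        unfold loss
        have h1 := hΦc.comp_continuousOn (hc t ht)
        exact continuousOn_const.mul ((continuousOn_id.sub h1).norm.pow 2)
      have hev : ∀ᶠ f' in 𝓝[B] f, loss Φ f' (w f' t) < ε ^ 2 / 2 :=
        (hcl f hf).eventually_lt_const hlt
      exact ⟨_, hev, t, ht, fun f' hf' => hf'.1⟩
  obtain ⟨T, hT, h⟩ := main
  refine ⟨fun f => w f T, hc T hT, fun f hf => ?_⟩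
  have h1 := h f hf
  unfold loss at h1
  rw [norm_sub_rev]
  have h2 : ‖f - Φ (w f T)‖ ^ 2 < ε ^ 2 := by linarith
  exact lt_of_pow_lt_pow_left₀ 2 hε.le h2

lemma smooth_g {W d : ℕ} (Φ : EuclideanSpace ℝ (Fin W) → EuclideanSpace ℝ (Fin d))
    (hΦ : ContDiff ℝ 1 Φ) (K : NNReal) (hlip : LipschitzWith K (fderiv ℝ Φ))
    (B : Set (EuclideanSpace ℝ (Fin d))) (hB : IsCompact B)
    (hBl : B ⊆ learnableSet Φ) (ε : ℝ) (hε : 0 < ε) :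
    ∃ g : EuclideanSpace ℝ (Fin d) → EuclideanSpace ℝ (Fin W), ContDiff ℝ 1 g ∧
      ∀ f ∈ B, ‖Φ (g f) - f‖ < ε := by
  obtain ⟨g, hg, hgε⟩ := uniform_T Φ hΦ K hlip B hB hBl (ε / 2) (by positivity)
  have hK := hB.image_of_continuousOn hg
  have hunif := hK.uniformContinuousAt_of_continuousAt Φ
    (fun a _ => hΦ.continuous.continuousAt) (Metric.dist_mem_uniformity (half_pos hε))
  obtain ⟨δ, hδ, hδ'⟩ := Metric.mem_uniformity_dist.1 hunif
  have hpi : ∃ η > 0, ∀ v : EuclideanSpace ℝ (Fin W), (∀ i, |v i| < η) → ‖v‖ < δ := by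
    have hc : Continuous (fun v : Fin W → ℝ => ‖(WithLp.toLp 2 v : EuclideanSpace ℝ (Fin W))‖) :=
      (PiLp.continuous_toLp 2 _).norm
    have hev : ∀ᶠ v in 𝓝 (0 : Fin W → ℝ), ‖(WithLp.toLp 2 v : EuclideanSpace ℝ (Fin W))‖ < δ := by
      refine hc.continuousAt.eventually_lt_const ?_
      simpa using hδ
    obtain ⟨η, hη, h⟩ := Metric.eventually_nhds_iff.1 hev
    refine ⟨η, hη, fun v hv => ?_⟩
    have := @h (fun i => v i) (by
      rw [dist_zero_right, pi_norm_lt_iff hη]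
      exact hv)
    exact this
  obtain ⟨η, hη, hηδ⟩ := hpi
  have happ : ∀ i : Fin W, ∃ q : MvPolynomial (Fin d) ℝ, ∀ x ∈ B,
      |MvPolynomial.eval (fun i => x i) q - g x i| < η := fun i =>
    poly_approx B hB (fun x => g x i)
      ((by fun_prop : Continuous fun v : EuclideanSpace ℝ (Fin W) => v i).comp_continuousOn hg) η hη
  choose q hq using happ
  refine ⟨fun x => WithLp.toLp 2 fun i => MvPolynomial.eval (fun j => x j) (q i), ?_, ?_⟩
  · rw [contDiff_euclidean]
    intro i
    simp only
    induction q i using MvPolynomial.induction_on with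
    | C a => simpa using contDiff_const
    | add p q hp hq => simpa using hp.add hq
    | mul_X p j hp =>
      simp only [map_mul, MvPolynomial.eval_X]
      exact hp.mul (by fun_prop)
  · intro f hf
    have h1 : dist (g f) (WithLp.toLp 2 fun i => MvPolynomial.eval (fun j => f j) (q i)) < δ := by
      rw [dist_comm, dist_eq_norm]
      apply hηδ
      intro i
      simpa using hq i f hf
    have h2 : dist (Φ (g f)) (Φ (WithLp.toLp 2 fun i => MvPolynomial.eval (fun j => f j) (q i)))
        < ε / 2 := hδ' h1 ⟨f, hf, rfl⟩
    have h3 := hgε f hf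
    rw [← dist_eq_norm] at h3 ⊢
    have h4 := dist_triangle (Φ (WithLp.toLp 2 fun i => MvPolynomial.eval (fun j => f j) (q i)))
      (Φ (g f)) f
    rw [dist_comm _ (Φ (g f))] at h4
    linarith

/-- If `W < d`, the non-learnable targets are dense in the target space. -/
theorem nonlearnable_dense (W d : ℕ) (hW : 1 ≤ W) (hWd : W < d)
    (Φ : EuclideanSpace ℝ (Fin W) → EuclideanSpace ℝ (Fin d))
    (hΦ : ContDiff ℝ 1 Φ) (K : NNReal) (hlip : LipschitzWith K (fderiv ℝ Φ)) :
    Dense ((learnableSet Φ)ᶜ) := by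
  rw [Metric.dense_iff]
  intro c ρ hρ
  by_contra hne
  have hsub : Metric.ball c ρ ⊆ learnableSet Φ := by
    intro x hx
    by_contra hxl
    exact hne ⟨x, hx, hxl⟩
  have hd := hΦ.dense_compl_range_of_finrank_lt_finrank (by simpa using hWd)
  obtain ⟨p, hpc, hpr⟩ := Metric.dense_iff.1 hd c (ρ / 2) (by positivity)
  set r := ρ / 4 with hr
  have hr0 : 0 < r := by positivity
  have hBsub : Metric.closedBall p r ⊆ learnableSet Φ := by
    refine Subset.trans ?_ hsub
    apply Metric.closedBall_subset_ball'
    rw [Metric.mem_ball] at hpc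
    linarith
  obtain ⟨g, hg, hgε⟩ := smooth_g Φ hΦ K hlip _ (isCompact_closedBall p r) hBsub (r / 4)
    (by positivity)
  let χ : ContDiffBump p := ⟨r / 2, r, by positivity, by linarith⟩
  obtain ⟨x, hx, hxp⟩ := perturb_surj (fun x => χ x • (Φ (g x) - x))
    (χ.contDiff.smul ((hΦ.comp hg).sub contDiff_id)) p r hr0 (by
      intro x hx
      have : χ x = 0 := χ.zero_of_le_dist (by
        rw [Metric.mem_closedBall, not_le] at hx
        exact hx.le)
      simp [this])
  by_cases hxr : x ∈ Metric.closedBall p (r / 2)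
  · have : χ x = 1 := χ.one_of_mem_closedBall hxr
    simp only [this, one_smul, add_sub_cancel] at hxp
    exact hpr ⟨_, hxp⟩
  · rw [Metric.mem_closedBall, not_le, dist_eq_norm] at hxr
    have h1 : x - p = -(χ x • (Φ (g x) - x)) := by
      rw [sub_eq_iff_eq_add, ← sub_eq_neg_add, eq_sub_iff_add_eq]
      exact hxp
    rw [h1, norm_neg, norm_smul, Real.norm_of_nonneg χ.nonneg] at hxr
    have h2 := hgε x hx
    have h3 : χ x ≤ 1 := χ.le_one
    have h4 := norm_nonneg (Φ (g x) - x)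
    nlinarith
end

section
/- The learnable set is Borel measurable: for Φ : ℝ^W → ℝ^d C¹ with Lipschitz differential, the set F_Φ = {f ∈ ℝ^d : inf_t L_f(w_f(t)) = 0} equals the countable intersection over n ≥ 1 of the sets {f : inf_t L_f(w_f(t)) < 1/n}, each of which is open (using continuous dependence of gradient flow trajectories on the target f); hence F_Φ is a Borel (indeed G_δ) subset of ℝ^d. -/
open MeasureTheory Filter Topology Set

/-- Targets whose gradient flow trajectory reaches loss `< 1/(n+1)` at some time. -/
def approxSet {W d : ℕ} (Φ : EuclideanSpace ℝ (Fin W) → EuclideanSpace ℝ (Fin d)) (n : ℕ) :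
    Set (EuclideanSpace ℝ (Fin d)) :=
  {f | ∃ w : ℝ → EuclideanSpace ℝ (Fin W), w 0 = 0 ∧
    (∀ t ≥ (0 : ℝ), HasDerivAt w (-(gradient (loss Φ f) (w t))) t) ∧
    ∃ t ≥ (0 : ℝ), loss Φ f (w t) < 1 / (n + 1)}

section Helpers

variable {W d : ℕ}

/-- The gradient flow field. -/
noncomputable def flowField (Φ : EuclideanSpace ℝ (Fin W) → EuclideanSpace ℝ (Fin d))
    (f : EuclideanSpace ℝ (Fin d)) (w : EuclideanSpace ℝ (Fin W)) : EuclideanSpace ℝ (Fin W) :=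
  ContinuousLinearMap.adjoint (fderiv ℝ Φ w) (f - Φ w)

variable {Φ : EuclideanSpace ℝ (Fin W) → EuclideanSpace ℝ (Fin d)}

lemma gradient_loss (hΦ : ContDiff ℝ 1 Φ) (f : EuclideanSpace ℝ (Fin d))
    (w : EuclideanSpace ℝ (Fin W)) :
    HasGradientAt (loss Φ f) (-(flowField Φ f w)) w := by
  have hd : HasFDerivAt Φ (fderiv ℝ Φ w) w :=
    (hΦ.differentiable (by norm_num) w).hasFDerivAt
  have h1 := ((hd.const_sub f).norm_sq).const_mul (1 / 2 : ℝ)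
  rw [hasGradientAt_iff_hasFDerivAt]
  refine h1.congr_fderiv ?_
  ext x
  simp [flowField, ContinuousLinearMap.adjoint_inner_left]

lemma neg_gradient_loss (hΦ : ContDiff ℝ 1 Φ) (f : EuclideanSpace ℝ (Fin d))
    (w : EuclideanSpace ℝ (Fin W)) :
    -(gradient (loss Φ f) w) = flowField Φ f w := by
  rw [(gradient_loss hΦ f w).gradient, neg_neg]

lemma loss_antitone (hΦ : ContDiff ℝ 1 Φ) (f : EuclideanSpace ℝ (Fin d)) {T : ℝ}
    {u : ℝ → EuclideanSpace ℝ (Fin W)} {θ : ℝ → ℝ} (hθ : ∀ t, 0 ≤ θ t)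
    (hu : ∀ t ∈ Icc 0 T, HasDerivAt u (θ t • flowField Φ f (u t)) t) :
    AntitoneOn (fun t => loss Φ f (u t)) (Icc 0 T) := by
  have key : ∀ t ∈ Icc 0 T, HasDerivAt (fun t => loss Φ f (u t))
      (-(θ t * ‖flowField Φ f (u t)‖ ^ 2)) t := by
    intro t ht
    have h := (gradient_loss hΦ f (u t)).hasFDerivAt.comp_hasDerivAt t (hu t ht)
    refine h.congr_deriv ?_
    rw [InnerProductSpace.toDual_apply_apply, inner_neg_left, inner_smul_right,
      real_inner_self_eq_norm_sq]
  apply antitoneOn_of_deriv_nonpos (convex_Icc 0 T)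
  · exact fun t ht => (key t ht).continuousAt.continuousWithinAt
  · exact fun t ht => (key t (interior_subset ht)).differentiableAt.differentiableWithinAt
  · intro t ht
    rw [(key t (interior_subset ht)).deriv]
    have := hθ t
    have : 0 ≤ θ t * ‖flowField Φ f (u t)‖ ^ 2 := by positivity
    linarith

lemma fderiv_bound {K : NNReal} (hlip : LipschitzWith K (fderiv ℝ Φ))
    (w : EuclideanSpace ℝ (Fin W)) : ‖fderiv ℝ Φ w‖ ≤ ‖fderiv ℝ Φ 0‖ + K * ‖w‖ := by
  have h := hlip.dist_le_mul w 0
  rw [dist_eq_norm, dist_zero_right] at h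
  have := norm_le_norm_add_norm_sub (fderiv ℝ Φ 0) (fderiv ℝ Φ w)
  rw [norm_sub_rev] at this
  linarith

lemma flowField_norm_le (f : EuclideanSpace ℝ (Fin d)) (w : EuclideanSpace ℝ (Fin W)) :
    ‖flowField Φ f w‖ ≤ ‖fderiv ℝ Φ w‖ * ‖f - Φ w‖ := by
  have := (ContinuousLinearMap.adjoint (fderiv ℝ Φ w)).le_opNorm (f - Φ w)
  rwa [LinearIsometryEquiv.norm_map] at this

/-- A priori bound for (slowed down) trajectories. -/
lemma apriori (hΦ : ContDiff ℝ 1 Φ) {K : NNReal} (hlip : LipschitzWith K (fderiv ℝ Φ))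
    (f : EuclideanSpace ℝ (Fin d)) {T M : ℝ} (hM : ‖f - Φ 0‖ ≤ M)
    {u : ℝ → EuclideanSpace ℝ (Fin W)} {θ : ℝ → ℝ} (hθ : ∀ t, 0 ≤ θ t) (hθ1 : ∀ t, θ t ≤ 1)
    (h0 : u 0 = 0)
    (hu : ∀ t ∈ Icc 0 T, HasDerivAt u (θ t • flowField Φ f (u t)) t) :
    ∀ t ∈ Icc 0 T, ‖u t‖ ≤ gronwallBound 0 (K * M) (‖fderiv ℝ Φ 0‖ * M) T := by
  have hM0 : 0 ≤ M := (norm_nonneg _).trans hM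
  have hanti := loss_antitone hΦ f hθ hu
  have hres : ∀ t ∈ Icc 0 T, ‖f - Φ (u t)‖ ≤ M := by
    intro t ht
    have h := hanti (left_mem_Icc.2 (ht.1.trans ht.2)) ht ht.1
    simp only [loss, h0] at h
    have h2 : ‖f - Φ (u t)‖ ^ 2 ≤ ‖f - Φ 0‖ ^ 2 := by linarith
    exact (le_of_sq_le_sq h2 (norm_nonneg _)).trans hM
  intro t ht
  have hg := norm_le_gronwallBound_of_norm_deriv_right_le (f := u)
    (f' := fun t => θ t • flowField Φ f (u t)) (δ := 0) (K := K * M)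
    (ε := ‖fderiv ℝ Φ 0‖ * M) (a := 0) (b := T)
    (fun t ht => (hu t ht).continuousAt.continuousWithinAt)
    (fun t ht => (hu t ⟨ht.1, ht.2.le⟩).hasDerivWithinAt) (by simp [h0]) (by
      intro s hs
      have hs' : s ∈ Icc 0 T := ⟨hs.1, hs.2.le⟩
      rw [norm_smul, Real.norm_of_nonneg (hθ s)]
      calc θ s * ‖flowField Φ f (u s)‖ ≤ 1 * ‖flowField Φ f (u s)‖ := by
            gcongr; exact hθ1 s
        _ ≤ ‖fderiv ℝ Φ (u s)‖ * ‖f - Φ (u s)‖ := by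
            rw [one_mul]; exact flowField_norm_le f (u s)
        _ ≤ (‖fderiv ℝ Φ 0‖ + K * ‖u s‖) * M := by
            gcongr
            · exact fderiv_bound hlip _
            · exact hres s hs'
        _ = _ := by ring) t ht
  refine hg.trans ?_
  apply gronwallBound_mono le_rfl (by positivity) (by positivity)
  linarith [ht.2]

lemma flowField_local (hΦ : ContDiff ℝ 1 Φ) {K : NNReal} (hlip : LipschitzWith K (fderiv ℝ Φ))
    (f : EuclideanSpace ℝ (Fin d)) (R : ℝ) :
    ∃ C : NNReal, LipschitzOnWith C (flowField Φ f) (Metric.closedBall 0 R) ∧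
      (∀ x ∈ Metric.closedBall 0 R, ‖flowField Φ f x‖ ≤ C) ∧
      (∀ x ∈ Metric.closedBall 0 R, ∀ g, ‖flowField Φ g x - flowField Φ f x‖ ≤ C * ‖g - f‖) := by
  by_cases hR : R < 0
  · refine ⟨0, ?_⟩
    simp [Metric.closedBall_eq_empty.2 hR]
  push Not at hR
  set A := ‖fderiv ℝ Φ 0‖ + K * R with hA
  have hA0 : 0 ≤ A := by positivity
  have hD : ∀ x ∈ Metric.closedBall (0 : EuclideanSpace ℝ (Fin W)) R, ‖fderiv ℝ Φ x‖ ≤ A := by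
    intro x hx
    rw [mem_closedBall_zero_iff] at hx
    exact (fderiv_bound hlip x).trans (by rw [hA]; gcongr)
  have hL : ∀ x ∈ Metric.closedBall (0 : EuclideanSpace ℝ (Fin W)) R,
      ∀ y ∈ Metric.closedBall (0 : EuclideanSpace ℝ (Fin W)) R, ‖Φ y - Φ x‖ ≤ A * ‖y - x‖ := by
    intro x hx y hy
    exact Convex.norm_image_sub_le_of_norm_fderiv_le
      (fun x _ => hΦ.differentiable (by norm_num) x) hD (convex_closedBall _ _) hx hy
  set B := ‖f - Φ 0‖ + A * R with hB
  have hB0 : 0 ≤ B := by positivity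
  have hres : ∀ x ∈ Metric.closedBall (0 : EuclideanSpace ℝ (Fin W)) R, ‖f - Φ x‖ ≤ B := by
    intro x hx
    have h1 := hL x hx 0 (by simpa using hR)
    rw [zero_sub, norm_neg] at h1
    have hx' := mem_closedBall_zero_iff.1 hx
    calc ‖f - Φ x‖ = ‖(f - Φ 0) + (Φ 0 - Φ x)‖ := by congr 1; abel
      _ ≤ ‖f - Φ 0‖ + ‖Φ 0 - Φ x‖ := norm_add_le _ _
      _ ≤ ‖f - Φ 0‖ + A * R := by
        gcongr
        exact h1.trans (by gcongr)
  refine ⟨⟨K * B + A * A + A * B + A, by positivity⟩, ?_, ?_, ?_⟩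
  · apply LipschitzOnWith.of_dist_le_mul
    intro x hx y hy
    rw [dist_eq_norm, dist_eq_norm]
    have e : flowField Φ f x - flowField Φ f y =
        ContinuousLinearMap.adjoint (fderiv ℝ Φ x - fderiv ℝ Φ y) (f - Φ x) +
        ContinuousLinearMap.adjoint (fderiv ℝ Φ y) (Φ y - Φ x) := by
      simp only [flowField, map_sub, sub_apply]
      abel
    rw [e]
    have h1 := (ContinuousLinearMap.adjoint (fderiv ℝ Φ x - fderiv ℝ Φ y)).le_opNorm (f - Φ x)
    have h2 := (ContinuousLinearMap.adjoint (fderiv ℝ Φ y)).le_opNorm (Φ y - Φ x)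
    rw [LinearIsometryEquiv.norm_map] at h1 h2
    have h3 := hlip.dist_le_mul x y
    rw [dist_eq_norm, dist_eq_norm] at h3
    have h4 := hL x hx y hy
    rw [norm_sub_rev y x] at h4
    calc _ ≤ ‖fderiv ℝ Φ x - fderiv ℝ Φ y‖ * ‖f - Φ x‖ + ‖fderiv ℝ Φ y‖ * ‖Φ y - Φ x‖ :=
          (norm_add_le _ _).trans (add_le_add h1 h2)
      _ ≤ (K * ‖x - y‖) * B + A * (A * ‖x - y‖) := by
          gcongr
          · exact hres x hx
          · exact hD y hy
      _ = (K * B + A * A) * ‖x - y‖ := by ring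
      _ ≤ (K * B + A * A + A * B + A) * ‖x - y‖ := by
          refine mul_le_mul_of_nonneg_right ?_ (norm_nonneg _)
          nlinarith [mul_nonneg hA0 hB0]
  · intro x hx
    calc _ ≤ _ := flowField_norm_le f x
      _ ≤ A * B := by
        gcongr
        · exact hD x hx
        · exact hres x hx
      _ ≤ K * B + A * A + A * B + A := by
        have : 0 ≤ K * B := by positivity
        nlinarith
  · intro x hx g
    have e : flowField Φ g x - flowField Φ f x =
        ContinuousLinearMap.adjoint (fderiv ℝ Φ x) (g - f) := by
      simp only [flowField, map_sub]
      abel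
    rw [e]
    have h2 := (ContinuousLinearMap.adjoint (fderiv ℝ Φ x)).le_opNorm (g - f)
    rw [LinearIsometryEquiv.norm_map] at h2
    refine h2.trans ?_
    gcongr
    refine (hD x hx).trans ?_
    change A ≤ K * B + A * A + A * B + A
    have : 0 ≤ K * B := by positivity
    nlinarith [mul_nonneg hA0 hB0]

/-- Scalar cutoff. -/
noncomputable def cutoff (R : ℝ) (w : EuclideanSpace ℝ (Fin W)) : ℝ :=
  max 0 (min 1 (R + 1 - ‖w‖))

lemma cutoff_nonneg (R : ℝ) (w : EuclideanSpace ℝ (Fin W)) : 0 ≤ cutoff R w := le_max_left _ _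

lemma cutoff_le_one (R : ℝ) (w : EuclideanSpace ℝ (Fin W)) : cutoff R w ≤ 1 :=
  max_le zero_le_one (min_le_left _ _)

lemma cutoff_eq_one {R : ℝ} {w : EuclideanSpace ℝ (Fin W)} (h : ‖w‖ ≤ R) : cutoff R w = 1 := by
  unfold cutoff
  rw [min_eq_left (by linarith), max_eq_right zero_le_one]

lemma cutoff_eq_zero {R : ℝ} {w : EuclideanSpace ℝ (Fin W)} (h : R + 1 < ‖w‖) :
    cutoff R w = 0 := by
  unfold cutoff
  exact max_eq_left ((min_le_right _ _).trans (by linarith))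

lemma cutoff_lip (R : ℝ) (x y : EuclideanSpace ℝ (Fin W)) :
    |cutoff R x - cutoff R y| ≤ ‖x - y‖ := by
  unfold cutoff
  calc _ ≤ |min 1 (R + 1 - ‖x‖) - min 1 (R + 1 - ‖y‖)| := abs_max_sub_max_le_abs _ _ _ |>.trans_eq' (by rw [max_comm 0, max_comm 0])
    _ ≤ |(R + 1 - ‖x‖) - (R + 1 - ‖y‖)| := by
      have := abs_min_sub_min_le_max 1 (R + 1 - ‖x‖) 1 (R + 1 - ‖y‖)
      simpa using this
    _ = |‖y‖ - ‖x‖| := by congr 1; ring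
    _ ≤ ‖x - y‖ := by rw [norm_sub_rev]; exact abs_norm_sub_norm_le _ _

lemma cutoff_field (hΦ : ContDiff ℝ 1 Φ) {K : NNReal} (hlip : LipschitzWith K (fderiv ℝ Φ))
    (f : EuclideanSpace ℝ (Fin d)) (R : ℝ) :
    ∃ C : NNReal, LipschitzWith C (fun w => cutoff R w • flowField Φ f w) ∧
      ∀ w, ‖cutoff R w • flowField Φ f w‖ ≤ C := by
  obtain ⟨C, h1, h2, -⟩ := flowField_local hΦ hlip f (R + 1)
  have key : ∀ x y : EuclideanSpace ℝ (Fin W), ‖x‖ ≤ R + 1 →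
      ‖cutoff R x • flowField Φ f x - cutoff R y • flowField Φ f y‖ ≤ (C + C) * ‖x - y‖ := by
    intro x y hx
    have hx' := mem_closedBall_zero_iff.2 hx
    by_cases hy : ‖y‖ ≤ R + 1
    · have hy' := mem_closedBall_zero_iff.2 hy
      have e : cutoff R x • flowField Φ f x - cutoff R y • flowField Φ f y =
        (cutoff R x - cutoff R y) • flowField Φ f x +
          cutoff R y • (flowField Φ f x - flowField Φ f y) := by
        rw [sub_smul, smul_sub]; abel
      rw [e]
      have h3 := h1.dist_le_mul x hx' y hy'
      rw [dist_eq_norm, dist_eq_norm] at h3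
      calc _ ≤ |cutoff R x - cutoff R y| * ‖flowField Φ f x‖ +
            cutoff R y * ‖flowField Φ f x - flowField Φ f y‖ := by
            refine (norm_add_le _ _).trans_eq ?_
            rw [norm_smul, norm_smul, Real.norm_eq_abs, Real.norm_of_nonneg (cutoff_nonneg R y)]
        _ ≤ ‖x - y‖ * C + 1 * (C * ‖x - y‖) := by
            gcongr
            · exact cutoff_lip R x y
            · exact h2 x hx'
            · exact cutoff_le_one R y
        _ = _ := by ring
    · push Not at hy
      have h0 := cutoff_lip R x y
      rw [cutoff_eq_zero hy, sub_zero, abs_of_nonneg (cutoff_nonneg R x)] at h0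
      rw [cutoff_eq_zero hy, zero_smul, sub_zero, norm_smul,
        Real.norm_of_nonneg (cutoff_nonneg R x)]
      calc _ ≤ ‖x - y‖ * C := by
            gcongr
            exact h2 x hx'
        _ ≤ _ := by nlinarith [mul_nonneg C.coe_nonneg (norm_nonneg (x - y))]
  refine ⟨C + C, LipschitzWith.of_dist_le_mul ?_, ?_⟩
  · intro x y
    rw [dist_eq_norm, dist_eq_norm, NNReal.coe_add]
    by_cases hx : ‖x‖ ≤ R + 1
    · exact key x y hx
    by_cases hy : ‖y‖ ≤ R + 1
    · rw [norm_sub_rev, norm_sub_rev x y]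
      exact key y x hy
    push Not at hx hy
    simp only [cutoff_eq_zero hx, cutoff_eq_zero hy, zero_smul, sub_zero, norm_zero]
    positivity
  · intro w
    by_cases hw : ‖w‖ ≤ R + 1
    · rw [norm_smul, Real.norm_of_nonneg (cutoff_nonneg R w), NNReal.coe_add]
      calc _ ≤ 1 * (C : ℝ) := by
            gcongr
            · exact cutoff_le_one R w
            · exact h2 w (mem_closedBall_zero_iff.2 hw)
        _ ≤ _ := by have := C.coe_nonneg; linarith
    · push Not at hw
      rw [cutoff_eq_zero hw, zero_smul, norm_zero]
      positivity

lemma exists_on (hΦ : ContDiff ℝ 1 Φ) {K : NNReal} (hlip : LipschitzWith K (fderiv ℝ Φ))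
    (f : EuclideanSpace ℝ (Fin d)) (T : ℝ) (hT : 0 ≤ T) :
    ∃ u : ℝ → EuclideanSpace ℝ (Fin W), u 0 = 0 ∧
      ∀ t ∈ Icc 0 T, HasDerivAt u (flowField Φ f (u t)) t := by
  set R := gronwallBound 0 (K * ‖f - Φ 0‖) (‖fderiv ℝ Φ 0‖ * ‖f - Φ 0‖) T with hR
  obtain ⟨C, hC1, hC2⟩ := cutoff_field hΦ hlip f R
  have h0 : (0 : ℝ) ∈ Icc (-(T + 1)) (T + 1) := ⟨by linarith, by linarith⟩
  have hPL : IsPicardLindelof (fun _ : ℝ => fun w => cutoff R w • flowField Φ f w)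
      (⟨0, h0⟩ : Icc (-(T + 1)) (T + 1)) (0 : EuclideanSpace ℝ (Fin W))
      (C * ⟨T + 1, by linarith⟩) 0 C C :=
    { lipschitzOnWith := fun _ _ => hC1.lipschitzOnWith
      continuousOn := fun _ _ => continuousOn_const
      norm_le := fun _ _ x _ => hC2 x
      mul_max_le := by
        simp only [sub_zero, zero_sub, neg_neg, max_self, NNReal.coe_mul, NNReal.coe_zero]
        exact le_rfl }
  obtain ⟨u, hu0, hu⟩ := hPL.exists_eq_forall_mem_Icc_hasDerivWithinAt₀
  have hu' : ∀ t ∈ Icc 0 T, HasDerivAt u (cutoff R (u t) • flowField Φ f (u t)) t := by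
    intro t ht
    exact (hu t ⟨by linarith [ht.1], by linarith [ht.2]⟩).hasDerivAt
      (Icc_mem_nhds (by linarith [ht.1]) (by linarith [ht.2]))
  have hb := apriori hΦ hlip f le_rfl (θ := fun t => cutoff R (u t))
    (fun t => cutoff_nonneg _ _) (fun t => cutoff_le_one _ _) hu0 hu'
  refine ⟨u, hu0, fun t ht => ?_⟩
  have := hu' t ht
  rwa [cutoff_eq_one (hb t ht), one_smul] at this

lemma dist_traj (hΦ : ContDiff ℝ 1 Φ) {K : NNReal} (hlip : LipschitzWith K (fderiv ℝ Φ))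
    (f : EuclideanSpace ℝ (Fin d)) (T M : ℝ) (hM : ‖f - Φ 0‖ ≤ M)
    {u : ℝ → EuclideanSpace ℝ (Fin W)} (hu0 : u 0 = 0)
    (hu : ∀ t ∈ Icc 0 T, HasDerivAt u (flowField Φ f (u t)) t) :
    ∃ C : NNReal, ∀ (g : EuclideanSpace ℝ (Fin d)) (v : ℝ → EuclideanSpace ℝ (Fin W)),
      ‖g - Φ 0‖ ≤ M → v 0 = 0 → (∀ t ∈ Icc 0 T, HasDerivAt v (flowField Φ g (v t)) t) →
      ∀ t ∈ Icc 0 T, dist (v t) (u t) ≤ gronwallBound 0 C (C * ‖g - f‖) t := by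
  obtain ⟨C, h1, -, h3⟩ := flowField_local hΦ hlip f
    (gronwallBound 0 (K * M) (‖fderiv ℝ Φ 0‖ * M) T)
  refine ⟨C, fun g v hg hv0 hv t ht => ?_⟩
  have hbu := apriori hΦ hlip f hM (θ := fun _ => 1) (fun _ => zero_le_one) (fun _ => le_rfl) hu0
    (by simpa using hu)
  have hbv := apriori hΦ hlip g hg (θ := fun _ => 1) (fun _ => zero_le_one) (fun _ => le_rfl) hv0
    (by simpa using hv)
  have sub : ∀ {t : ℝ}, t ∈ Ico 0 T → t ∈ Icc 0 T := fun ht => ⟨ht.1, ht.2.le⟩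
  have := dist_le_of_approx_trajectories_ODE_of_mem (v := fun _ => flowField Φ f)
    (s := fun _ => Metric.closedBall 0 (gronwallBound 0 (K * M) (‖fderiv ℝ Φ 0‖ * M) T))
    (K := C) (f := v) (g := u) (f' := fun t => flowField Φ g (v t))
    (g' := fun t => flowField Φ f (u t)) (a := 0) (b := T) (εf := C * ‖g - f‖) (εg := 0) (δ := 0)
    (fun _ _ => h1)
    (fun t ht => (hv t ht).continuousAt.continuousWithinAt)
    (fun t ht => (hv t (sub ht)).hasDerivWithinAt)
    (fun t ht => by
      rw [dist_eq_norm]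
      exact h3 _ (mem_closedBall_zero_iff.2 (hbv t (sub ht))) g)
    (fun t ht => mem_closedBall_zero_iff.2 (hbv t (sub ht)))
    (fun t ht => (hu t ht).continuousAt.continuousWithinAt)
    (fun t ht => (hu t (sub ht)).hasDerivWithinAt)
    (fun t ht => by simp)
    (fun t ht => mem_closedBall_zero_iff.2 (hbu t (sub ht)))
    (by simp [hu0, hv0]) t ht
  simpa using this

lemma traj_unique (hΦ : ContDiff ℝ 1 Φ) {K : NNReal} (hlip : LipschitzWith K (fderiv ℝ Φ))
    (f : EuclideanSpace ℝ (Fin d)) {T : ℝ}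
    {u v : ℝ → EuclideanSpace ℝ (Fin W)} (hu0 : u 0 = 0)
    (hu : ∀ t ∈ Icc 0 T, HasDerivAt u (flowField Φ f (u t)) t) (hv0 : v 0 = 0)
    (hv : ∀ t ∈ Icc 0 T, HasDerivAt v (flowField Φ f (v t)) t) :
    ∀ t ∈ Icc 0 T, v t = u t := by
  obtain ⟨C, hC⟩ := dist_traj hΦ hlip f T _ le_rfl hu0 hu
  intro t ht
  have := hC f v le_rfl hv0 hv t ht
  rw [sub_self, norm_zero, mul_zero, gronwallBound_ε0_δ0] at this
  exact dist_le_zero.1 this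

lemma exists_global (hΦ : ContDiff ℝ 1 Φ) {K : NNReal} (hlip : LipschitzWith K (fderiv ℝ Φ))
    (f : EuclideanSpace ℝ (Fin d)) :
    ∃ u : ℝ → EuclideanSpace ℝ (Fin W), u 0 = 0 ∧
      ∀ t ≥ (0 : ℝ), HasDerivAt u (flowField Φ f (u t)) t := by
  choose u hu0 hu using fun n : ℕ => exists_on hΦ hlip f n n.cast_nonneg
  have hcons : ∀ (m n : ℕ) (t : ℝ), 0 ≤ t → t ≤ m → t ≤ n → u m t = u n t := by
    intro m n t h0 hm hn
    exact traj_unique hΦ hlip f (T := t) (hu0 n) (fun s hs => hu n s ⟨hs.1, hs.2.trans hn⟩)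
      (hu0 m) (fun s hs => hu m s ⟨hs.1, hs.2.trans hm⟩) t ⟨h0, le_rfl⟩
  have hfl : ∀ t : ℝ, t ≤ ((⌊t⌋₊ + 1 : ℕ) : ℝ) := fun t => by
    push_cast; exact (Nat.lt_floor_add_one t).le
  refine ⟨fun t => u (⌊t⌋₊ + 1) t, hu0 _, fun t ht => ?_⟩
  rcases ht.eq_or_lt with rfl | ht
  · have h := hu 1 0 ⟨le_rfl, by simp⟩
    have e : (fun t => u (⌊t⌋₊ + 1) t) =ᶠ[𝓝 0] u 1 := by
      filter_upwards [Iio_mem_nhds (zero_lt_one' ℝ)] with s hs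
      rw [Nat.floor_eq_zero.2 hs]
    simpa using h.congr_of_eventuallyEq e
  · set N := ⌊t⌋₊ + 1 with hN
    have h := hu (N + 1) t ⟨ht.le, (hfl t).trans (by push_cast [hN]; linarith)⟩
    have e : (fun t => u (⌊t⌋₊ + 1) t) =ᶠ[𝓝 t] u (N + 1) := by
      filter_upwards [Ioo_mem_nhds ht (lt_add_one t)] with s hs
      refine hcons _ _ s hs.1.le (hfl s) ?_
      have := hfl t
      push_cast at this ⊢
      rw [hN]; push_cast
      linarith [hs.2]
    have h2 := h.congr_of_eventuallyEq e
    rwa [← e.eq_of_nhds] at h2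

end Helpers

/-- The learnable set is a countable intersection of open sets, hence a Borel (`Gδ`) set. -/
theorem learnableSet_borel (W d : ℕ)
    (Φ : EuclideanSpace ℝ (Fin W) → EuclideanSpace ℝ (Fin d))
    (hΦ : ContDiff ℝ 1 Φ) (K : NNReal) (hlip : LipschitzWith K (fderiv ℝ Φ)) :
    (∀ n : ℕ, IsOpen (approxSet Φ n)) ∧
    (learnableSet Φ = ⋂ n : ℕ, approxSet Φ n) ∧
    MeasurableSet (learnableSet Φ) := by
  have hopen : ∀ n : ℕ, IsOpen (approxSet Φ n) := by
    intro n
    rw [isOpen_iff_mem_nhds]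
    rintro f ⟨u, hu0, hu, t, ht, hlt⟩
    simp only [neg_gradient_loss hΦ] at hu
    obtain ⟨C, hC⟩ := dist_traj hΦ hlip f t (‖f - Φ 0‖ + 1) (by linarith) hu0
      (fun s hs => hu s hs.1)
    choose v hv0 hv using fun g => exists_global hΦ hlip g
    have hnear : ∀ᶠ g in 𝓝 f, ‖g - Φ 0‖ < ‖f - Φ 0‖ + 1 :=
      (by fun_prop : Continuous fun g : EuclideanSpace ℝ (Fin d) => ‖g - Φ 0‖).continuousAt.eventually_lt
        continuousAt_const (by simp)
    have hg0 : Tendsto (fun g => gronwallBound 0 C (C * ‖g - f‖) t) (𝓝 f) (𝓝 0) := by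
      have hc : Continuous (fun g : EuclideanSpace ℝ (Fin d) =>
          gronwallBound 0 C (C * ‖g - f‖) t) :=
        (gronwallBound_continuous_ε 0 C t).comp (by fun_prop)
      have := hc.tendsto f
      simpa [gronwallBound_ε0_δ0] using this
    have hvt : Tendsto (fun g => v g t) (𝓝 f) (𝓝 (u t)) := by
      rw [tendsto_iff_dist_tendsto_zero]
      refine squeeze_zero' (Eventually.of_forall fun _ => dist_nonneg) ?_ hg0
      filter_upwards [hnear] with g hg
      exact hC g (v g) hg.le (hv0 g) (fun s hs => hv g s hs.1) t ⟨ht, le_rfl⟩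
    have hloss : Tendsto (fun g => loss Φ g (v g t)) (𝓝 f) (𝓝 (loss Φ f (u t))) := by
      unfold loss
      exact (((tendsto_id.sub ((hΦ.continuous.tendsto _).comp hvt)).norm).pow 2).const_mul _
    filter_upwards [hloss.eventually_lt_const hlt] with g hg
    refine ⟨v g, hv0 g, ?_, t, ht, hg⟩
    simpa only [neg_gradient_loss hΦ] using hv g
  have heq : learnableSet Φ = ⋂ n : ℕ, approxSet Φ n := by
    ext f
    simp only [mem_iInter]
    constructor
    · rintro ⟨w, h0, hw, hinf⟩ n
      have : (⨅ t : Set.Ici (0 : ℝ), loss Φ f (w t)) < 1 / ((n : ℝ) + 1) := by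
        rw [hinf]; positivity
      obtain ⟨t, ht⟩ := exists_lt_of_ciInf_lt this
      exact ⟨w, h0, hw, t, t.2, ht⟩
    · intro h
      choose w hw0 hw t ht hlt using h
      refine ⟨w 0, hw0 0, hw 0, ?_⟩
      simp only [neg_gradient_loss hΦ] at hw
      have hnn : ∀ x, 0 ≤ loss Φ f x := fun x => by unfold loss; positivity
      refine le_antisymm ?_ (Real.iInf_nonneg fun _ => hnn _)
      refine le_of_forall_pos_lt_add fun ε hε => ?_
      obtain ⟨n, hn⟩ := exists_nat_one_div_lt hε
      have e : w 0 (t n) = w n (t n) := traj_unique hΦ hlip f (T := t n) (hw0 n)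
        (fun s hs => hw n s hs.1) (hw0 0) (fun s hs => hw 0 s hs.1) (t n) ⟨ht n, le_rfl⟩
      have hle : (⨅ t : Set.Ici (0 : ℝ), loss Φ f (w 0 t)) ≤ loss Φ f (w 0 (t n)) :=
        ciInf_le ⟨0, by rintro _ ⟨s, rfl⟩; exact hnn _⟩ (⟨t n, ht n⟩ : Set.Ici (0 : ℝ))
      rw [e] at hle
      linarith [hlt n]
  refine ⟨hopen, heq, ?_⟩
  rw [heq]
  exact MeasurableSet.iInter fun n => (hopen n).measurableSet
end
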